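/- arXiv:1802.01277 — 3 statements merged into one kernel-verified Lean document; each statement's English description precedes it below -/
import Mathlib

section
/- Let (x̄,λ̄) be a KKT point of the unperturbed problem (a,b)=(0,0). Then the multiplier λ̄ is noncritical (i.e., the generalized equation 0 ∈ ∇²ₓₓL(x̄,λ̄)ξ + ∇g(x̄)* D N_K(g(x̄)|λ̄)(g'(x̄)ξ) has only the trivial solution ξ = 0) if and only if every solution (ξ,v) ∈ X × Y of the system ∇²ₓₓL(x̄,λ̄)ξ + ∇g(x̄)*v = 0 and g'(x̄)ξ − Π_K'(g(x̄)+λ̄; g'(x̄)ξ + v) = 0 has ξ = 0, where Π_K'(z; h) denotes the directional derivative of the projection Π_K at z in direction h (which exists since K is C²-cone reducible). -/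
open Set Filter Topology Metric Pointwise
open scoped RealInnerProductSpace Classical

noncomputable section

/-- The normal cone of convex analysis: `N_K(z) = {l | ⟪l, y - z⟫ ≤ 0 ∀ y ∈ K}`,
empty when `z ∉ K`. -/
def nCone {E : Type*} [NormedAddCommGroup E] [InnerProductSpace ℝ E]
    (K : Set E) (z : E) : Set E :=
  {l | z ∈ K ∧ ∀ y ∈ K, ⟪l, y - z⟫ ≤ 0}

/-- The metric projection onto `K`: under the standing assumptions (`K` nonempty,
closed and convex in a finite-dimensional space) the distance minimizer exists and
is unique, so this choice-based definition is exactly the metric projection `Π_K`. -/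

def projK {E : Type*} [NormedAddCommGroup E] [InnerProductSpace ℝ E]
    (K : Set E) (z : E) : E :=
  if h : ∃ p, p ∈ K ∧ ∀ y ∈ K, ‖z - p‖ ≤ ‖z - y‖ then h.choose else 0

/-- A set `D` is a pointed closed convex cone. -/
def PointedClosedConvexCone {E : Type*} [NormedAddCommGroup E] [NormedSpace ℝ E]
    (D : Set E) : Prop :=
  IsClosed D ∧ Convex ℝ D ∧ (∀ t : ℝ, 0 ≤ t → ∀ z ∈ D, t • z ∈ D) ∧ D ∩ (-D) ⊆ {0}

/-- `K` is `C²`-cone reducible at `y`: near `y`, `K` is the inverse image of a pointed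
closed convex cone `D` under a twice continuously differentiable map `Ξ` with `Ξ y = 0`
and `Ξ'(y)` surjective.  (Since the target of the reduction is a finite-dimensional
space of dimension at most `dim Y`, it can be taken to be a Euclidean space.) -/
def C2ConeReducibleAt {Y : Type*} [NormedAddCommGroup Y] [InnerProductSpace ℝ Y]
    (K : Set Y) (y : Y) : Prop :=
  ∃ (m : ℕ) (U : Set Y) (D : Set (EuclideanSpace ℝ (Fin m)))
    (Ξ : Y → EuclideanSpace ℝ (Fin m)),
      IsOpen U ∧ y ∈ U ∧ PointedClosedConvexCone D ∧ ContDiffOn ℝ 2 Ξ U ∧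
      Ξ y = 0 ∧ Function.Surjective (fderiv ℝ Ξ y) ∧ K ∩ U = {y' ∈ U | Ξ y' ∈ D}

/-- `K` is `C²`-cone reducible (at every point of `K`). -/
def C2ConeReducible {Y : Type*} [NormedAddCommGroup Y] [InnerProductSpace ℝ Y]
    (K : Set Y) : Prop :=
  ∀ y ∈ K, C2ConeReducibleAt K y

/-- Calmness of a set-valued map `F` at `z0` for `w0 ∈ F z0`. -/
def Calm {Z W : Type*} [NormedAddCommGroup Z] [NormedAddCommGroup W]
    (F : Z → Set W) (z0 : Z) (w0 : W) : Prop :=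
  ∃ κ ε δ : ℝ, 0 < κ ∧ 0 < ε ∧ 0 < δ ∧
    ∀ z : Z, ‖z - z0‖ ≤ ε → ∀ w ∈ F z, ‖w - w0‖ ≤ δ →
      ∃ w' ∈ F z0, ‖w - w'‖ ≤ κ * ‖z - z0‖

/-- Isolated calmness of a set-valued map `F` at `z0` for `w0 ∈ F z0`. -/
def IsolatedCalm {Z W : Type*} [NormedAddCommGroup Z] [NormedAddCommGroup W]
    (F : Z → Set W) (z0 : Z) (w0 : W) : Prop :=
  ∃ κ ε δ : ℝ, 0 < κ ∧ 0 < ε ∧ 0 < δ ∧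
    ∀ z : Z, ‖z - z0‖ ≤ ε → ∀ w ∈ F z, ‖w - w0‖ ≤ δ →
      ‖w - w0‖ ≤ κ * ‖z - z0‖

/-- Metric subregularity of `F` at `z0` for `w0 ∈ F z0`:
`dist(z, F⁻¹(w0)) ≤ κ · dist(w0, F z ∩ B_δ(w0))` for `z` near `z0`; since the
right-hand side is an infimum over `F z ∩ B_δ(w0)` (`= +∞` when empty), this is
equivalently stated pointwise. -/
def MetricallySubregular {Z W : Type*} [NormedAddCommGroup Z] [NormedAddCommGroup W]
    (F : Z → Set W) (z0 : Z) (w0 : W) : Prop :=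
  ∃ κ ε δ : ℝ, 0 < κ ∧ 0 < ε ∧ 0 < δ ∧
    ∀ z : Z, ‖z - z0‖ ≤ ε → ∀ w ∈ F z, ‖w - w0‖ ≤ δ →
      infDist z {z' : Z | w0 ∈ F z'} ≤ κ * ‖w0 - w‖

/-- `φ` has directional derivative `w` at `z` in direction `h`. -/
def HasDirDeriv {E : Type*} [NormedAddCommGroup E] [NormedSpace ℝ E]
    (φ : E → E) (z h w : E) : Prop :=
  Tendsto (fun t : ℝ => t⁻¹ • (φ (z + t • h) - φ z)) (𝓝[>] (0 : ℝ)) (𝓝 w)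

/-- The contingent (Bouligand) tangent cone to `s` at `z`. -/
def contCone {E : Type*} [NormedAddCommGroup E] [NormedSpace ℝ E]
    (s : Set E) (z : E) : Set E :=
  {w | ∃ (t : ℕ → ℝ) (v : ℕ → E), (∀ n, 0 < t n) ∧ Tendsto t atTop (𝓝 0) ∧
        Tendsto v atTop (𝓝 w) ∧ ∀ n, z + t n • v n ∈ s}

/-- The negative polar cone of a set. -/
def negPolar {E : Type*} [NormedAddCommGroup E] [InnerProductSpace ℝ E]
    (C : Set E) : Set E :=
  {z | ∀ d ∈ C, ⟪z, d⟫ ≤ 0}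

/-- The critical cone `C_K(y,u) = T_K(y) ∩ u^⊥`. -/
def criticalCone {E : Type*} [NormedAddCommGroup E] [InnerProductSpace ℝ E]
    (K : Set E) (y u : E) : Set E :=
  contCone K y ∩ {d | ⟪u, d⟫ = 0}

/-- The (outer) second-order tangent set `T²_K(y,h)`. -/
def secondOrderTangent {E : Type*} [NormedAddCommGroup E] [NormedSpace ℝ E]
    (K : Set E) (y h : E) : Set E :=
  {w | ∃ (t : ℕ → ℝ) (v : ℕ → E), (∀ n, 0 < t n) ∧ Tendsto t atTop (𝓝 0) ∧
        Tendsto v atTop (𝓝 w) ∧ ∀ n, y + t n • h + ((t n) ^ 2 / 2) • v n ∈ K}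

variable {X Y : Type*} [NormedAddCommGroup X] [InnerProductSpace ℝ X]
  [FiniteDimensional ℝ X] [NormedAddCommGroup Y] [InnerProductSpace ℝ Y]
  [FiniteDimensional ℝ Y]

/-- The KKT solution map of the canonically perturbed problem:
`∇f(x) + ∇g(x)*λ = a` and `λ ∈ N_K(g(x) − b)`. -/
def sKKT (f : X → ℝ) (g : X → Y) (K : Set Y) (a : X) (b : Y) : Set (X × Y) :=
  {p | gradient f p.1 + ContinuousLinearMap.adjoint (fderiv ℝ g p.1) p.2 = a ∧
       p.2 ∈ nCone K (g p.1 - b)}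

/-- The multiplier set map `M(x,a,b)`. -/
def mSet (f : X → ℝ) (g : X → Y) (K : Set Y) (x : X) (a : X) (b : Y) : Set Y :=
  {l | (x, l) ∈ sKKT f g K a b}

/-- The stationary point map `X_KKT(a,b)`. -/
def xKKT (f : X → ℝ) (g : X → Y) (K : Set Y) (a : X) (b : Y) : Set X :=
  {x | ∃ l, (x, l) ∈ sKKT f g K a b}

/-- The Hessian `∇²ₓₓL(x,λ)` of the Lagrangian `L(·,λ)` at `x`. -/
def hessLxx (f : X → ℝ) (g : X → Y) (x : X) (l : Y) : X →L[ℝ] X :=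
  fderiv ℝ (fun u => gradient (fun v => f v + ⟪l, g v⟫) u) x

/-- The multiplier `l0` is noncritical: the only solutions `(ξ,v)` of
`∇²ₓₓL(x̄,λ̄)ξ + ∇g(x̄)*v = 0`, `g'(x̄)ξ − Π_K'(g(x̄)+λ̄; g'(x̄)ξ+v) = 0` have `ξ = 0`. -/
def Noncritical (f : X → ℝ) (g : X → Y) (K : Set Y) (x0 : X) (l0 : Y) : Prop :=
  ∀ (ξ : X) (v : Y),
    hessLxx f g x0 l0 ξ + ContinuousLinearMap.adjoint (fderiv ℝ g x0) v = 0 →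
    HasDirDeriv (projK K) (g x0 + l0) (fderiv ℝ g x0 ξ + v) (fderiv ℝ g x0 ξ) →
    ξ = 0

/-- Strong calmness of `S_KKT` at the origin for `(x̄,λ̄)`. -/
def StrongCalm (f : X → ℝ) (g : X → Y) (K : Set Y) (x0 : X) (l0 : Y) : Prop :=
  ∃ δ ε κ : ℝ, 0 < δ ∧ 0 < ε ∧ 0 < κ ∧
    ∀ (a : X) (b : Y), ‖(a, b)‖ ≤ δ →
      ∀ (x : X) (l : Y), (x, l) ∈ sKKT f g K a b → ‖(x, l) - (x0, l0)‖ ≤ ε →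
        ‖x - x0‖ + infDist l (mSet f g K x0 0 0) ≤ κ * ‖(a, b)‖

/-- Pseudo-isolated calmness of `X_KKT` at the origin for `x̄` (relative to `λ̄`). -/
def PseudoIsolatedCalm (f : X → ℝ) (g : X → Y) (K : Set Y) (x0 : X) (l0 : Y) : Prop :=
  ∃ ε δ κ : ℝ, 0 < ε ∧ 0 < δ ∧ 0 < κ ∧
    ∀ (a : X) (b : Y), ‖(a, b)‖ ≤ δ →
      ∀ (x : X) (l : Y), (x, l) ∈ sKKT f g K a b → ‖(x, l) - (x0, l0)‖ ≤ ε →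
        ‖x - x0‖ ≤ κ * ‖(a, b)‖

theorem taylor2 (S : Y → ℝ) (x : Y) (hS : ContDiffAt ℝ 2 S x) {ε : ℝ} (hε : 0 < ε) :
    ∀ᶠ w in 𝓝 (0 : Y),
      ‖S (x + w) - S x - fderiv ℝ S x w - (1 / 2) * fderiv ℝ (fderiv ℝ S) x w w‖
        ≤ ε * ‖w‖ ^ 2 := by
  have h1 : ∀ᶠ z in 𝓝 x, DifferentiableAt ℝ S z :=
    (hS.eventually (by simp)).mono fun z hz => hz.differentiableAt (by simp)
  have h2 : HasFDerivAt (fderiv ℝ S) (fderiv ℝ (fderiv ℝ S) x) x := by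
    have : ContDiffAt ℝ 1 (fderiv ℝ S) x := hS.fderiv_right (by norm_num)
    exact (this.differentiableAt (by simp)).hasFDerivAt
  have h3 := (h2.isLittleO).def hε
  obtain ⟨r, hr, hb⟩ := Metric.eventually_nhds_iff_ball.1 (h1.and h3)
  filter_upwards [Metric.ball_mem_nhds (0 : Y) hr] with w hw
  rw [mem_ball_zero_iff] at hw
  have hmem : ∀ s ∈ Icc (0 : ℝ) 1, x + s • w ∈ ball x r := by
    intro s hs
    rw [mem_ball_iff_norm, add_sub_cancel_left, norm_smul, Real.norm_of_nonneg hs.1]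
    nlinarith [hs.1, hs.2, norm_nonneg w]
  set B := fderiv ℝ (fderiv ℝ S) x with hB
  have key := norm_image_sub_le_of_norm_deriv_le_segment_01'
    (f := fun s : ℝ => S (x + s • w) - s * fderiv ℝ S x w - (1 / 2) * s ^ 2 * B w w)
    (f' := fun s : ℝ => fderiv ℝ S (x + s • w) w - fderiv ℝ S x w - s * B w w)
    (C := ε * ‖w‖ ^ 2) ?_ ?_
  · simp at key
    convert key using 2
    simp
    ring_nf
  · intro s hs
    have hd := (hb _ (hmem s hs)).1.hasFDerivAt
    have hc : HasDerivAt (fun s : ℝ => x + s • w) w s := by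
      simpa using ((hasDerivAt_id s).smul_const w).const_add x
    have h4 := hd.comp_hasDerivAt s hc
    have h5 : HasDerivAt (fun s : ℝ => s * fderiv ℝ S x w) (fderiv ℝ S x w) s := by
      simpa using (hasDerivAt_id s).mul_const (fderiv ℝ S x w)
    have h6 : HasDerivAt (fun s : ℝ => (1 / 2) * s ^ 2 * B w w) (s * B w w) s := by
      have := (((hasDerivAt_id s).pow 2).const_mul (1 / 2 : ℝ)).mul_const (B w w)
      refine this.congr_deriv ?_
      simp
    exact ((h4.sub h5).sub h6).hasDerivWithinAt
  · intro s hs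
    have h7 := (hb _ (hmem s ⟨hs.1, hs.2.le⟩)).2
    rw [add_sub_cancel_left] at h7
    have h8 : fderiv ℝ S (x + s • w) w - fderiv ℝ S x w - s * B w w
        = (fderiv ℝ S (x + s • w) - fderiv ℝ S x - B (s • w)) w := by
      simp
    rw [h8]
    refine (ContinuousLinearMap.le_opNorm _ _).trans ?_
    have h9 : ‖s • w‖ ≤ ‖w‖ := by
      rw [norm_smul, Real.norm_of_nonneg hs.1]
      nlinarith [hs.1, hs.2, norm_nonneg w]
    calc _ ≤ (ε * ‖s • w‖) * ‖w‖ := by gcongr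
      _ ≤ (ε * ‖w‖) * ‖w‖ := by gcongr
      _ = _ := by ring

theorem taylor2_seq (S : Y → ℝ) (x : Y) (hS : ContDiffAt ℝ 2 S x)
    (t : ℕ → ℝ) (v : ℕ → Y) (u : Y) (ht : ∀ᶠ n in atTop, 0 < t n)
    (ht0 : Tendsto t atTop (𝓝 0)) (hv : Tendsto v atTop (𝓝 u)) :
    Tendsto (fun n => (S (x + t n • v n) - S x - t n * fderiv ℝ S x (v n)) / (t n) ^ 2)
      atTop (𝓝 ((1 / 2) * fderiv ℝ (fderiv ℝ S) x u u)) := by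
  set B := fderiv ℝ (fderiv ℝ S) x with hB
  have hBv : Tendsto (fun n => (1 / 2) * B (v n) (v n)) atTop (𝓝 ((1 / 2) * B u u)) := by
    have : Continuous (fun w : Y => (1 / 2) * B w w) := by fun_prop
    exact (this.tendsto u).comp hv
  have hw0 : Tendsto (fun n => t n • v n) atTop (𝓝 0) := by
    simpa using ht0.smul hv
  have hdiff : Tendsto (fun n => (S (x + t n • v n) - S x - t n * fderiv ℝ S x (v n)) / (t n) ^ 2
      - (1 / 2) * B (v n) (v n)) atTop (𝓝 0) := by
    rw [Metric.tendsto_nhds]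
    intro ε hε
    have hM : ∀ᶠ n in atTop, ‖v n‖ < ‖u‖ + 1 :=
      hv.norm.eventually_lt_const (by linarith)
    set M := ‖u‖ + 1 with hMdef
    have hMpos : 0 < M := by positivity
    have hδ : 0 < ε / (2 * M ^ 2) := by positivity
    filter_upwards [ht, hM, hw0.eventually (taylor2 S x hS hδ)] with n h1 h2 h3
    rw [dist_zero_right]
    have e1 : (S (x + t n • v n) - S x - t n * fderiv ℝ S x (v n)) / (t n) ^ 2
        - (1 / 2) * B (v n) (v n) = (S (x + t n • v n) - S x - fderiv ℝ S x (t n • v n)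
          - (1 / 2) * B (t n • v n) (t n • v n)) / (t n) ^ 2 := by
      simp
      field_simp
    rw [e1, norm_div, norm_pow, Real.norm_of_nonneg h1.le, div_lt_iff₀ (by positivity)]
    refine h3.trans_lt ?_
    rw [norm_smul, Real.norm_of_nonneg h1.le, mul_pow]
    have h4 : ‖v n‖ ^ 2 ≤ M ^ 2 := by gcongr
    calc ε / (2 * M ^ 2) * (t n ^ 2 * ‖v n‖ ^ 2) ≤ ε / (2 * M ^ 2) * (t n ^ 2 * M ^ 2) := by gcongr
      _ = ε / 2 * t n ^ 2 := by field_simp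
      _ < ε * t n ^ 2 := by
        have : 0 < t n ^ 2 := by positivity
        nlinarith
  simpa using hdiff.add hBv

structure RedData (K : Set Y) (y l : Y) (T : Set Y) (β : Y → ℝ) : Prop where
  mid : ∀ a ∈ T, ∀ b ∈ T, (1 / 2 : ℝ) • (a + b) ∈ T
  zero : (0 : Y) ∈ T
  F1 : ∀ (t : ℕ → ℝ) (v : ℕ → Y) (u : Y), (∀ᶠ n in atTop, 0 < t n) → Tendsto t atTop (𝓝 0) →
    Tendsto v atTop (𝓝 u) → (∀ᶠ n in atTop, y + t n • v n ∈ K) →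
    u ∈ T ∧ ∃ (e : ℕ → ℝ) (τ : ℕ → Y), Tendsto e atTop (𝓝 (β u)) ∧
      ∀ᶠ n in atTop, τ n ∈ T ∧ ⟪l, v n⟫ + t n * e n = ⟪l, τ n⟫
  F2 : ∀ d ∈ T, ∀ (t : ℕ → ℝ), (∀ᶠ n in atTop, 0 < t n) → Tendsto t atTop (𝓝 0) →
    ∃ (c : ℕ → Y) (e : ℕ → ℝ), Tendsto c atTop (𝓝 d) ∧ Tendsto e atTop (𝓝 (β d)) ∧
      ∀ᶠ n in atTop, y + t n • c n ∈ K ∧ ⟪l, c n⟫ + t n * e n = ⟪l, d⟫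

theorem exists_redData (K : Set Y) (y l : Y) (hy : y ∈ K) (hred : C2ConeReducibleAt K y) :
    ∃ T β, RedData K y l T β := by
  obtain ⟨m, U, D, Ξ, hU, hyU, ⟨hDcl, hDcv, hDcone, -⟩, hΞ, hΞy, hsurj, hKU⟩ := hred
  have hΞat : ContDiffAt ℝ 2 Ξ y := hΞ.contDiffAt (hU.mem_nhds hyU)
  set A := fderiv ℝ Ξ y with hA
  obtain ⟨R, hR⟩ := A.exists_rightInverse_of_surjective (LinearMap.range_eq_top.2 hsurj)
  have hAR : ∀ z, A (R z) = z := fun z => congrArg (fun f => f z) hR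
  let Φ : Y → Y := fun p => p + R (Ξ p - A (p - y))
  have hΦy : Φ y = y := by simp [Φ, hΞy]
  have hAΦ : ∀ p, A (Φ p - y) = Ξ p := by
    intro p
    have : Φ p - y = (p - y) + R (Ξ p - A (p - y)) := by simp only [Φ]; abel
    rw [this, map_add, hAR]
    abel
  have hΦc : ContDiffAt ℝ 2 Φ y := by
    refine contDiffAt_id.add (R.contDiff.contDiffAt.comp y (hΞat.sub ?_))
    exact A.contDiff.contDiffAt.comp y (contDiffAt_id.sub contDiffAt_const)
  have hΦd : HasStrictFDerivAt Φ ((ContinuousLinearEquiv.refl ℝ Y : Y ≃L[ℝ] Y) : Y →L[ℝ] Y) y := by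
    have h1 : HasStrictFDerivAt Ξ A y := hΞat.hasStrictFDerivAt (by simp)
    have h2 : HasStrictFDerivAt (fun p => A (p - y)) A y :=
      A.hasStrictFDerivAt.comp y ((hasStrictFDerivAt_id y).sub_const y)
    have h3 := (hasStrictFDerivAt_id (𝕜 := ℝ) y).add (R.hasStrictFDerivAt.comp y (h1.sub h2))
    refine h3.congr_fderiv ?_
    ext z
    simp
  set ψ := hΦd.localInverse Φ _ y with hψ
  have hψd : HasStrictFDerivAt ψ (((ContinuousLinearEquiv.refl ℝ Y).symm : Y ≃L[ℝ] Y) : Y →L[ℝ] Y)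
      y := by
    have := hΦd.to_localInverse
    rwa [hΦy] at this
  have hψy : ψ y = y := by
    have := hΦd.localInverse_apply_image
    rwa [hΦy] at this
  have hΦψ : ∀ᶠ q in 𝓝 y, Φ (ψ q) = q := by
    have := hΦd.eventually_right_inverse
    rwa [hΦy] at this
  let S : Y → ℝ := fun p => ⟪l, Φ p⟫
  have hS : ContDiffAt ℝ 2 S y := contDiffAt_const.inner ℝ hΦc
  have hS' : ∀ w, fderiv ℝ S y w = ⟪l, w⟫ := by
    intro w
    have h : HasFDerivAt S ((innerSL ℝ l).comp
      ((ContinuousLinearEquiv.refl ℝ Y : Y ≃L[ℝ] Y) : Y →L[ℝ] Y)) y :=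
      (innerSL ℝ l).hasFDerivAt.comp y hΦd.hasFDerivAt
    rw [h.fderiv]
    simp
  have hKiff : ∀ p ∈ U, p ∈ K ↔ Ξ p ∈ D := by
    intro p hp
    have : p ∈ K ∩ U ↔ p ∈ {y' ∈ U | Ξ y' ∈ D} := by rw [hKU]
    simpa [hp] using this
  let β : Y → ℝ := fun u => (1 / 2) * fderiv ℝ (fderiv ℝ S) y u u
  have hD0 : (0 : EuclideanSpace ℝ (Fin m)) ∈ D := by
    rw [← hΞy]; exact (hKiff y hyU).1 hy
  have hscale : ∀ (t : ℕ → ℝ) (v : ℕ → Y) (u : Y) (G : Y → Y), (∀ᶠ n in atTop, 0 < t n) →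
      Tendsto t atTop (𝓝 0) → Tendsto v atTop (𝓝 u) → G y = y →
      HasFDerivAt G (ContinuousLinearMap.id ℝ Y) y →
      Tendsto (fun n => (t n)⁻¹ • (G (y + t n • v n) - y)) atTop (𝓝 u) := by
    intro t v u G ht ht0 hv hG hGd
    have h := (hasFDerivWithinAt_univ.2 hGd).lim (l := atTop) (c := fun n => (t n)⁻¹)
      (d := fun n => t n • v n) (v := u) (by simpa using ht0.smul hv) (by simp) ?_
    · simpa [hG] using h
    · refine hv.congr' ?_
      filter_upwards [ht] with n hn
      rw [smul_smul, inv_mul_cancel₀ hn.ne', one_smul]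
  have hnear : ∀ (t : ℕ → ℝ) (v : ℕ → Y) (u : Y), Tendsto t atTop (𝓝 0) →
      Tendsto v atTop (𝓝 u) → Tendsto (fun n => y + t n • v n) atTop (𝓝 y) := by
    intro t v u ht0 hv
    simpa using tendsto_const_nhds.add (ht0.smul hv)
  refine ⟨{d | A d ∈ D}, β, ?_, ?_, ?_, ?_⟩
  · intro a ha b hb
    have := hDcv ha hb (a := 1 / 2) (b := 1 / 2) (by norm_num) (by norm_num) (by norm_num)
    simpa [smul_add] using this
  · simpa using hD0
  · intro t v u ht ht0 hv hK
    have hτ := hscale t v u Φ ht ht0 hv hΦy hΦd.hasFDerivAt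
    have hτT : ∀ᶠ n in atTop, A ((t n)⁻¹ • (Φ (y + t n • v n) - y)) ∈ D := by
      filter_upwards [ht, hK, (hnear t v u ht0 hv).eventually (hU.mem_nhds hyU)] with n h1 h2 h3
      rw [map_smul, hAΦ]
      exact hDcone _ (inv_nonneg.2 h1.le) _ ((hKiff _ h3).1 h2)
    refine ⟨hDcl.mem_of_tendsto ((A.continuous.tendsto u).comp hτ) hτT, _,
      fun n => (t n)⁻¹ • (Φ (y + t n • v n) - y),
      taylor2_seq S y hS t v u ht ht0 hv, ?_⟩
    filter_upwards [ht, hτT] with n h1 h2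
    refine ⟨h2, ?_⟩
    rw [hS', inner_smul_right, inner_sub_right]
    simp only [S, hΦy]
    field_simp
    ring
  · intro d hd t ht ht0
    have hc := hscale t (fun _ => d) d ψ ht ht0 tendsto_const_nhds hψy hψd.hasFDerivAt
    refine ⟨_, _, hc, taylor2_seq S y hS t _ d ht ht0 hc, ?_⟩
    filter_upwards [ht, (hnear t _ d ht0 hc).eventually (hU.mem_nhds hyU),
      (hnear t _ d ht0 tendsto_const_nhds).eventually hΦψ] with n h1 h2 h3
    have e1 : y + t n • (t n)⁻¹ • (ψ (y + t n • d) - y) = ψ (y + t n • d) := by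
      rw [smul_smul, mul_inv_cancel₀ h1.ne', one_smul]; abel
    rw [e1] at h2
    rw [e1]
    constructor
    · rw [hKiff _ h2, ← hAΦ, h3, add_sub_cancel_left, map_smul]
      exact hDcone _ h1.le _ hd
    · rw [hS', inner_smul_right, inner_sub_right]
      simp only [S, hΦy, h3, inner_add_right, inner_smul_right]
      field_simp
      ring

theorem RedData.nonpos {K : Set Y} {y l : Y} {T : Set Y} {β : Y → ℝ} (H : RedData K y l T β)
    (hl : l ∈ nCone K y) : ∀ d ∈ T, ⟪l, d⟫ ≤ 0 := by
  intro d hd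
  have ht : ∀ᶠ n : ℕ in atTop, (0 : ℝ) < 1 / ((n : ℝ) + 1) := .of_forall fun n => by positivity
  obtain ⟨c, e, hc, -, h⟩ := H.F2 d hd _ ht tendsto_one_div_add_atTop_nhds_zero_nat
  refine le_of_tendsto ((tendsto_const_nhds (x := l)).inner hc) ?_
  filter_upwards [h, ht] with n h1 h2
  have := hl.2 _ h1.1
  rw [add_sub_cancel_left, inner_smul_right] at this
  nlinarith

theorem RedData.convex {K : Set Y} {y l : Y} {T : Set Y} {β : Y → ℝ} (H : RedData K y l T β)
    (hK : Convex ℝ K) (hl : l ∈ nCone K y) (a b : Y) (ha : a ∈ T) (hb : b ∈ T)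
    (hla : ⟪l, a⟫ = 0) (hlb : ⟪l, b⟫ = 0) :
    β ((1 / 2 : ℝ) • (a + b)) ≤ (1 / 2) * β a + (1 / 2) * β b := by
  set t : ℕ → ℝ := fun n => 1 / ((n : ℝ) + 1) with htdef
  have ht : ∀ᶠ n : ℕ in atTop, 0 < t n := .of_forall fun n => by simp only [t]; positivity
  have ht0 : Tendsto t atTop (𝓝 0) := tendsto_one_div_add_atTop_nhds_zero_nat
  obtain ⟨c, e, hc, he, h⟩ := H.F2 a ha t ht ht0
  obtain ⟨c', e', hc', he', h'⟩ := H.F2 b hb t ht ht0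
  obtain ⟨-, e'', τ, he'', h''⟩ := H.F1 t (fun n => (1 / 2 : ℝ) • (c n + c' n)) _ ht ht0
    ((hc.add hc').const_smul _) (by
      filter_upwards [h, h'] with n h1 h2
      have := hK h1.1 h2.1 (a := 1 / 2) (b := 1 / 2) (by norm_num) (by norm_num) (by norm_num)
      convert this using 1
      module)
  refine le_of_tendsto_of_tendsto he'' ((he.const_mul (1 / 2)).add (he'.const_mul (1 / 2))) ?_
  filter_upwards [h, h', h'', ht] with n h1 h2 h3 h4
  have h5 := H.nonpos hl _ h3.1
  have h6 := h3.2
  rw [inner_smul_right, inner_add_right] at h6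
  have h7 := h1.2
  have h8 := h2.2
  rw [hla] at h7
  rw [hlb] at h8
  have : t n * e'' n ≤ t n * ((1 / 2) * e n + (1 / 2) * e' n) := by linarith
  exact le_of_mul_le_mul_left this h4

theorem RedData.cluster {K : Set Y} {y l : Y} {T : Set Y} {β : Y → ℝ} (H : RedData K y l T β)
    (hl : l ∈ nCone K y) (t : ℕ → ℝ) (v k : ℕ → Y) (u h : Y)
    (ht : ∀ᶠ n in atTop, 0 < t n) (ht0 : Tendsto t atTop (𝓝 0)) (hv : Tendsto v atTop (𝓝 u))
    (hk : Tendsto k atTop (𝓝 h))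
    (hmin : ∀ᶠ n in atTop, y + t n • v n ∈ K ∧
      ∀ p ∈ K, ‖(y + l + t n • k n) - (y + t n • v n)‖ ≤ ‖(y + l + t n • k n) - p‖) :
    u ∈ T ∧ ⟪l, u⟫ = 0 ∧ ∀ d ∈ T, ⟪l, d⟫ = 0 →
      2 * β u + ‖h - u‖ ^ 2 ≤ 2 * β d + ‖h - d‖ ^ 2 := by
  obtain ⟨huT, e, τ, he, hτ⟩ := H.F1 t v u ht ht0 hv (hmin.mono fun n hn => hn.1)
  -- basic comparison
  have hcmp : ∀ n, 0 < t n → (∀ p ∈ K, ‖(y + l + t n • k n) - (y + t n • v n)‖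
      ≤ ‖(y + l + t n • k n) - p‖) → ∀ c, y + t n • c ∈ K →
      -2 * ⟪l, v n⟫ + t n * ‖k n - v n‖ ^ 2 ≤ -2 * ⟪l, c⟫ + t n * ‖k n - c‖ ^ 2 := by
    intro n hn hm c hc
    have h1 := hm _ hc
    have ex : ∀ c : Y, ‖(y + l + t n • k n) - (y + t n • c)‖ ^ 2 =
        ‖l‖ ^ 2 + 2 * t n * ⟪l, k n⟫ + t n * (-2 * ⟪l, c⟫ + t n * ‖k n - c‖ ^ 2) := by
      intro c
      have : (y + l + t n • k n) - (y + t n • c) = l + t n • (k n - c) := by module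
      rw [this, norm_add_sq_real, norm_smul, inner_smul_right, inner_sub_right, mul_pow,
        Real.norm_eq_abs, sq_abs]
      ring
    have h2 : ‖(y + l + t n • k n) - (y + t n • v n)‖ ^ 2
        ≤ ‖(y + l + t n • k n) - (y + t n • c)‖ ^ 2 := by gcongr
    rw [ex, ex] at h2
    have : t n * (-2 * ⟪l, v n⟫ + t n * ‖k n - v n‖ ^ 2)
      ≤ t n * (-2 * ⟪l, c⟫ + t n * ‖k n - c‖ ^ 2) := by linarith
    exact le_of_mul_le_mul_left this hn
  refine ⟨huT, le_antisymm (H.nonpos hl u huT) ?_, ?_⟩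
  · have hlim : Tendsto (fun n => t n * ‖k n - 0‖ ^ 2) atTop (𝓝 (0 * ‖h - 0‖ ^ 2)) :=
      ht0.mul ((hk.sub tendsto_const_nhds).norm.pow 2)
    have hlim2 : Tendsto (fun n => -2 * ⟪l, v n⟫) atTop (𝓝 (-2 * ⟪l, u⟫)) :=
      ((tendsto_const_nhds (x := l)).inner hv).const_mul (-2)
    have := le_of_tendsto_of_tendsto hlim2 hlim (by
      filter_upwards [ht, hmin] with n h1 h2
      have h3 := hcmp n h1 h2.2 0 (by simpa using hl.1)
      simp only [inner_zero_right, mul_zero, zero_add] at h3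
      have : 0 ≤ t n * ‖k n - v n‖ ^ 2 := by positivity
      linarith)
    linarith
  · intro d hd hld
    obtain ⟨c, e', hc, he', h'⟩ := H.F2 d hd t ht ht0
    refine le_of_tendsto_of_tendsto ((he.const_mul 2).add ((hk.sub hv).norm.pow 2))
      ((he'.const_mul 2).add ((hk.sub hc).norm.pow 2)) ?_
    filter_upwards [ht, hmin, hτ, h'] with n h1 h2 h3 h4
    have h5 := hcmp n h1 h2.2 _ h4.1
    have h6 := H.nonpos hl _ h3.1
    have h7 := h3.2
    have h8 := h4.2
    rw [hld] at h8
    have : t n * (2 * e n + ‖k n - v n‖ ^ 2) ≤ t n * (2 * e' n + ‖k n - c n‖ ^ 2) := by linarith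
    exact le_of_mul_le_mul_left this h1

theorem RedData.unique {K : Set Y} {y l : Y} {T : Set Y} {β : Y → ℝ} (H : RedData K y l T β)
    (hK : Convex ℝ K) (hl : l ∈ nCone K y) (u u' h : Y)
    (hu : u ∈ T ∧ ⟪l, u⟫ = 0 ∧ ∀ d ∈ T, ⟪l, d⟫ = 0 →
      2 * β u + ‖h - u‖ ^ 2 ≤ 2 * β d + ‖h - d‖ ^ 2)
    (hu' : u' ∈ T ∧ ⟪l, u'⟫ = 0 ∧ ∀ d ∈ T, ⟪l, d⟫ = 0 →
      2 * β u' + ‖h - u'‖ ^ 2 ≤ 2 * β d + ‖h - d‖ ^ 2) : u' = u := by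
  have hm := H.mid u hu.1 u' hu'.1
  have hlm : ⟪l, (1 / 2 : ℝ) • (u + u')⟫ = 0 := by
    rw [inner_smul_right, inner_add_right, hu.2.1, hu'.2.1]; simp
  have h1 := hu.2.2 _ hm hlm
  have h2 := hu'.2.2 _ hm hlm
  have h3 := H.convex hK hl u u' hu.1 hu'.1 hu.2.1 hu'.2.1
  have h4 : ‖h - (1 / 2 : ℝ) • (u + u')‖ ^ 2 =
      (1 / 2) * ‖h - u‖ ^ 2 + (1 / 2) * ‖h - u'‖ ^ 2 - (1 / 4) * ‖u' - u‖ ^ 2 := by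
    have e1 : h - (1 / 2 : ℝ) • (u + u') = (1 / 2 : ℝ) • ((h - u) + (h - u')) := by module
    have e2 : u' - u = (h - u) - (h - u') := by abel
    have e3 := parallelogram_law_with_norm ℝ (h - u) (h - u')
    rw [e1, e2, norm_smul, mul_pow, Real.norm_of_nonneg (by norm_num : (0 : ℝ) ≤ 1 / 2)]
    nlinarith [e3]
  have h5 : ‖u' - u‖ ^ 2 ≤ 0 := by linarith
  have h6 : ‖u' - u‖ = 0 := by
    have := sq_nonneg ‖u' - u‖
    exact pow_eq_zero_iff (two_ne_zero) |>.1 (le_antisymm h5 this)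
  exact sub_eq_zero.1 (norm_eq_zero.1 h6)

theorem projK_spec {K : Set Y} (hne : K.Nonempty) (hcl : IsClosed K) (z : Y) :
    projK K z ∈ K ∧ ∀ p ∈ K, ‖z - projK K z‖ ≤ ‖z - p‖ := by
  have h : ∃ p, p ∈ K ∧ ∀ y ∈ K, ‖z - p‖ ≤ ‖z - y‖ := by
    obtain ⟨p, hp, hd⟩ := hcl.exists_infDist_eq_dist hne z
    refine ⟨p, hp, fun y hy => ?_⟩
    rw [← dist_eq_norm, ← dist_eq_norm, ← hd]
    exact infDist_le_dist_of_mem hy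
  unfold projK
  rw [dif_pos h]
  exact h.choose_spec

theorem normal_of_min {K : Set Y} (hcv : Convex ℝ K) (z p : Y) (hp : p ∈ K)
    (hmin : ∀ q ∈ K, ‖z - p‖ ≤ ‖z - q‖) : z - p ∈ nCone K p := by
  refine ⟨hp, (norm_eq_iInf_iff_real_inner_le_zero hcv hp).1 ?_⟩
  have : Nonempty K := ⟨⟨p, hp⟩⟩
  refine le_antisymm (le_ciInf fun w => hmin w w.2) ?_
  exact ciInf_le (f := fun w : K => ‖z - w‖) ⟨0, by rintro _ ⟨w, rfl⟩; exact norm_nonneg _⟩ ⟨p, hp⟩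

theorem nCone_lip {K : Set Y} {p q a b : Y} (ha : a ∈ nCone K p) (hb : b ∈ nCone K q) :
    ‖p - q‖ ≤ ‖(p + a) - (q + b)‖ := by
  have h1 := ha.2 q hb.1
  have h2 := hb.2 p ha.1
  have h3 : 0 ≤ ⟪p - q, a - b⟫ := by
    have e1 : ⟪p - q, a - b⟫ = -⟪a, q - p⟫ - ⟪b, p - q⟫ := by
      rw [inner_sub_right, real_inner_comm, real_inner_comm b (p - q), ← inner_neg_right, neg_sub]
    linarith
  have h4 : (p + a) - (q + b) = (p - q) + (a - b) := by abel
  have h5 : ‖p - q‖ ^ 2 ≤ ‖(p + a) - (q + b)‖ ^ 2 := by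
    rw [h4, norm_add_sq_real]
    nlinarith [sq_nonneg ‖a - b‖]
  exact le_of_sq_le_sq h5 (norm_nonneg _)

theorem projK_normal {K : Set Y} (hne : K.Nonempty) (hcl : IsClosed K) (hcv : Convex ℝ K) (z : Y) :
    z - projK K z ∈ nCone K (projK K z) :=
  normal_of_min hcv z _ (projK_spec hne hcl z).1 (projK_spec hne hcl z).2

theorem projK_eq {K : Set Y} (hne : K.Nonempty) (hcl : IsClosed K) (hcv : Convex ℝ K) {p a : Y}
    (ha : a ∈ nCone K p) : projK K (p + a) = p := by
  have := nCone_lip (projK_normal hne hcl hcv (p + a)) ha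
  simp only [add_sub_cancel, sub_self, norm_zero] at this
  exact sub_eq_zero.1 (norm_le_zero_iff.1 this)

theorem projK_lip {K : Set Y} (hne : K.Nonempty) (hcl : IsClosed K) (hcv : Convex ℝ K) (z z' : Y) :
    ‖projK K z - projK K z'‖ ≤ ‖z - z'‖ := by
  simpa using nCone_lip (projK_normal hne hcl hcv z) (projK_normal hne hcl hcv z')

theorem tangent_of_dirDeriv {K : Set Y} (hne : K.Nonempty) (hcl : IsClosed K) (hcv : Convex ℝ K)
    {y l u w : Y} (hl : l ∈ nCone K y) (h : HasDirDeriv (projK K) (y + l) (u + w) u) :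
    (u, w) ∈ contCone {p : Y × Y | p.2 ∈ nCone K p.1} (y, l) := by
  set t : ℕ → ℝ := fun n => 1 / ((n : ℝ) + 1) with htdef
  have ht : ∀ n, 0 < t n := fun n => by simp only [t]; positivity
  have ht0 : Tendsto t atTop (𝓝 0) := tendsto_one_div_add_atTop_nhds_zero_nat
  have ht1 : Tendsto t atTop (𝓝[>] 0) :=
    tendsto_nhdsWithin_iff.2 ⟨ht0, .of_forall ht⟩
  have h1 := Tendsto.comp h ht1
  set a : ℕ → Y := fun n => (t n)⁻¹ • (projK K (y + l + t n • (u + w)) - projK K (y + l)) with hadef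
  have ha : Tendsto a atTop (𝓝 u) := h1
  refine ⟨t, fun n => (a n, (u + w) - a n), ht, ht0, ?_, ?_⟩
  · have := ha.prodMk_nhds ((tendsto_const_nhds (x := u + w)).sub ha)
    simpa using this
  · intro n
    have e1 : y + t n • a n = projK K (y + l + t n • (u + w)) := by
      simp only [a]
      rw [smul_smul, mul_inv_cancel₀ (ht n).ne', one_smul, projK_eq hne hcl hcv hl]
      abel
    have e2 : l + t n • ((u + w) - a n) = (y + l + t n • (u + w)) - (y + t n • a n) := by module
    show l + t n • ((u + w) - a n) ∈ nCone K (y + t n • a n)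
    rw [e2, e1]
    exact projK_normal hne hcl hcv _

theorem dirDeriv_of_tangent {K : Set Y} (hne : K.Nonempty) (hcl : IsClosed K) (hcv : Convex ℝ K)
    {y l u w : Y} (hred : C2ConeReducibleAt K y) (hl : l ∈ nCone K y)
    (h : (u, w) ∈ contCone {p : Y × Y | p.2 ∈ nCone K p.1} (y, l)) :
    HasDirDeriv (projK K) (y + l) (u + w) u := by
  obtain ⟨T, β, H⟩ := exists_redData K y l hl.1 hred
  obtain ⟨t, v, ht, ht0, hv, hmem⟩ := h
  have hPy : projK K (y + l) = y := projK_eq hne hcl hcv hl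
  have hv1 : Tendsto (fun n => (v n).1) atTop (𝓝 u) := (continuous_fst.tendsto _).comp hv
  have hv2 : Tendsto (fun n => (v n).2) atTop (𝓝 w) := (continuous_snd.tendsto _).comp hv
  have hu := H.cluster hl t (fun n => (v n).1) (fun n => (v n).1 + (v n).2) u (u + w)
    (.of_forall ht) ht0 hv1 (hv1.add hv2) (by
      refine .of_forall fun n => ?_
      have h1 : l + t n • (v n).2 ∈ nCone K (y + t n • (v n).1) := hmem n
      have h2 := projK_eq hne hcl hcv h1
      have e : (y + t n • (v n).1) + (l + t n • (v n).2)
        = y + l + t n • ((v n).1 + (v n).2) := by module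
      rw [e] at h2
      have h3 := projK_spec hne hcl (y + l + t n • ((v n).1 + (v n).2))
      rw [h2] at h3
      exact h3)
  refine tendsto_of_subseq_tendsto fun s hs => ?_
  obtain ⟨hs0, hspos⟩ := tendsto_nhdsWithin_iff.1 hs
  set a : ℝ → Y := fun t => t⁻¹ • (projK K (y + l + t • (u + w)) - projK K (y + l)) with hadef
  have hbd : ∀ r, 0 < r → a r ∈ closedBall (0 : Y) ‖u + w‖ := by
    intro r hr
    rw [mem_closedBall_zero_iff]
    simp only [a]
    rw [norm_smul, norm_inv, Real.norm_of_nonneg hr.le, inv_mul_le_iff₀ hr]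
    refine (projK_lip hne hcl hcv _ _).trans_eq ?_
    rw [add_sub_cancel_left, norm_smul, Real.norm_of_nonneg hr.le]
  obtain ⟨u', -, φ, hφ, hlim⟩ := (isCompact_closedBall (0 : Y) ‖u + w‖).tendsto_subseq'
    (x := fun n => a (s n)) ((hspos.mono fun n hn => hbd _ hn).frequently)
  have hφt := hφ.tendsto_atTop
  have hu' := H.cluster hl (s ∘ φ) (fun n => a (s (φ n))) (fun _ => u + w) u' (u + w)
    (hφt.eventually hspos) (hs0.comp hφt) hlim tendsto_const_nhds (by
      filter_upwards [hφt.eventually hspos] with n hn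
      have hn' : 0 < s (φ n) := hn
      have e1 : y + s (φ n) • a (s (φ n)) = projK K (y + l + s (φ n) • (u + w)) := by
        simp only [a]
        rw [smul_smul, mul_inv_cancel₀ hn'.ne', one_smul, hPy]
        abel
      simp only [Function.comp]
      rw [e1]
      exact projK_spec hne hcl _)
  have := H.unique hcv hl u u' (u + w) hu hu'
  rw [this] at hlim
  exact ⟨φ, hlim⟩

/-- Proposition 2.5: `λ̄` is noncritical in the graphical-derivative
sense (the generalized equation `0 ∈ ∇²ₓₓL(x̄,λ̄)ξ + ∇g(x̄)* D N_K(g(x̄)|λ̄)(g'(x̄)ξ)` has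
only the trivial solution `ξ = 0`) iff every solution `(ξ,v)` of
`∇²ₓₓL(x̄,λ̄)ξ + ∇g(x̄)*v = 0`, `g'(x̄)ξ − Π_K'(g(x̄)+λ̄; g'(x̄)ξ+v) = 0` has `ξ = 0`. -/
theorem stmt_3 (f : X → ℝ) (g : X → Y) (K : Set Y)
    (hf : ContDiff ℝ 2 f) (hg : ContDiff ℝ 2 g)
    (hKne : K.Nonempty) (hKcl : IsClosed K) (hKcv : Convex ℝ K)
    (hKred : C2ConeReducible K)
    (x0 : X) (l0 : Y) (hKKT : (x0, l0) ∈ sKKT f g K 0 0) :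
    (∀ ξ : X, (∃ w : Y,
        (fderiv ℝ g x0 ξ, w) ∈ contCone {p : Y × Y | p.2 ∈ nCone K p.1} (g x0, l0) ∧
        hessLxx f g x0 l0 ξ + ContinuousLinearMap.adjoint (fderiv ℝ g x0) w = 0) → ξ = 0)
    ↔ Noncritical f g K x0 l0 := by
  have hl : l0 ∈ nCone K (g x0) := by
    have := hKKT.2
    simpa using this
  constructor
  · intro h ξ v h1 h2
    exact h ξ ⟨v, tangent_of_dirDeriv hKne hKcl hKcv hl h2, h1⟩
  · rintro h ξ ⟨w, h1, h2⟩
    exact h ξ w h2 (dirDeriv_of_tangent hKne hKcl hKcv (hKred _ hl.1) hl h1)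

end
end

section
/- Let x̄ be a stationary point of the unperturbed problem (a,b)=(0,0) and λ̄ ∈ M(x̄,0,0). The set-valued map X(λ,a,b) = {x ∈ X : (x,λ) ∈ S_KKT(a,b)} is isolated calm at (λ̄,0,0) for x̄ if and only if ξ = 0 is the unique solution of the system ∇²ₓₓL(x̄,λ̄)ξ = 0 and g'(x̄)ξ − Π_K'(g(x̄)+λ̄; g'(x̄)ξ) = 0, where Π_K'(z; h) denotes the directional derivative of the metric projection Π_K at z in direction h. -/
open Set Filter Topology Metric Pointwise
open scoped RealInnerProductSpace Classical

noncomputable section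

variable {X Y : Type*} [NormedAddCommGroup X] [InnerProductSpace ℝ X]
  [FiniteDimensional ℝ X] [NormedAddCommGroup Y] [InnerProductSpace ℝ Y]
  [FiniteDimensional ℝ Y]

theorem aux_lim {E F ι : Type*} [NormedAddCommGroup E] [NormedSpace ℝ E]
    [NormedAddCommGroup F] [NormedSpace ℝ F] {G : E → F} {G' : E →L[ℝ] F} {x0 : E}
    (hG : HasFDerivAt G G' x0) {l : Filter ι} {t : ι → ℝ} {x : ι → E} {v : E}
    (ht : Tendsto t l (𝓝 0)) (htp : ∀ᶠ n in l, 0 < t n)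
    (hx : Tendsto (fun n => (t n)⁻¹ • (x n - x0)) l (𝓝 v)) :
    Tendsto (fun n => (t n)⁻¹ • (G (x n) - G x0)) l (𝓝 (G' v)) := by
  have hd : Tendsto (fun n => x n - x0) l (𝓝 0) := by
    have h1 := ht.smul hx
    rw [zero_smul] at h1
    refine h1.congr' ?_
    filter_upwards [htp] with n hn
    rw [smul_smul, mul_inv_cancel₀ hn.ne', one_smul]
  have := (hasFDerivWithinAt_univ.2 hG).lim hd (.of_forall fun _ ↦ mem_univ _) hx
  simpa using this

theorem aux_tendsto {E ι : Type*} [NormedAddCommGroup E] [NormedSpace ℝ E]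
    {x0 : E} {l : Filter ι} {t : ι → ℝ} {x : ι → E} {v : E}
    (ht : Tendsto t l (𝓝 0)) (htp : ∀ᶠ n in l, 0 < t n)
    (hx : Tendsto (fun n => (t n)⁻¹ • (x n - x0)) l (𝓝 v)) :
    Tendsto x l (𝓝 x0) := by
  have h1 := ht.smul hx
  rw [zero_smul] at h1
  have h2 := h1.add_const x0
  rw [zero_add] at h2
  refine h2.congr' ?_
  filter_upwards [htp] with n hn
  rw [smul_smul, mul_inv_cancel₀ hn.ne', one_smul, sub_add_cancel]

theorem aux_taylor {E : Type*} [NormedAddCommGroup E] [NormedSpace ℝ E]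
    {ψ : E → ℝ} {y0 : E} (hψ : ContDiffAt ℝ 2 ψ y0) (h0 : ψ y0 = 0) (h1 : fderiv ℝ ψ y0 = 0) :
    (fun y => ψ y - 2⁻¹ * fderiv ℝ (fderiv ℝ ψ) y0 (y - y0) (y - y0)) =o[𝓝 y0]
      (fun y => ‖y - y0‖ ^ 2) := by
  set Q := fderiv ℝ (fderiv ℝ ψ) y0 with hQ
  have hsymm : ∀ u v, Q u v = Q v u := by
    have := hψ.isSymmSndFDerivAt (by simp)
    intro u v
    exact this u v
  have hd2 : HasFDerivAt (fderiv ℝ ψ) Q y0 := by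
    have : ContDiffAt ℝ 1 (fderiv ℝ ψ) y0 := hψ.fderiv_right (by norm_num)
    exact (this.differentiableAt (by norm_num)).hasFDerivAt
  have hdiff : ∀ᶠ y in 𝓝 y0, DifferentiableAt ℝ ψ y := by
    filter_upwards [hψ.eventually (by simp)] with y hy
    exact hy.differentiableAt (by norm_num)
  rw [Asymptotics.isLittleO_iff]
  intro c hc
  have hlo := (hasFDerivAt_iff_isLittleO.1 hd2).def hc
  obtain ⟨r, hr, hball⟩ := Metric.eventually_nhds_iff_ball.1 (hdiff.and hlo)
  filter_upwards [Metric.ball_mem_nhds y0 hr] with y hy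
  have hsub : Metric.closedBall y0 ‖y - y0‖ ⊆ Metric.ball y0 r := by
    intro z hz
    rw [Metric.mem_closedBall] at hz
    rw [Metric.mem_ball] at hy ⊢
    rw [dist_eq_norm] at hy
    linarith
  have hder : ∀ z ∈ Metric.closedBall y0 ‖y - y0‖,
      HasFDerivWithinAt (fun y => ψ y - 2⁻¹ * Q (y - y0) (y - y0))
        (fderiv ℝ ψ z - Q (z - y0)) (Metric.closedBall y0 ‖y - y0‖) z := by
    intro z hz
    have hz' := (hball z (hsub hz)).1.hasFDerivAt
    have hid : HasFDerivAt (fun y : E => y - y0) (ContinuousLinearMap.id ℝ E) z :=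
      (hasFDerivAt_id z).sub_const y0
    have hq := (((Q.hasFDerivAt (x := z - y0)).comp z hid).clm_apply hid).const_mul (2⁻¹ : ℝ)
    have := (hz'.sub hq).hasFDerivWithinAt (s := Metric.closedBall y0 ‖y - y0‖)
    refine this.congr_fderiv ?_
    ext v
    simp
    rw [hsymm v z, hsymm v y0]
    ring
  have hbd : ∀ z ∈ Metric.closedBall y0 ‖y - y0‖,
      ‖fderiv ℝ ψ z - Q (z - y0)‖ ≤ c * ‖y - y0‖ := by
    intro z hz
    have := (hball z (hsub hz)).2
    rw [h1, sub_zero] at this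
    refine this.trans ?_
    gcongr
    rw [Metric.mem_closedBall, dist_eq_norm] at hz
    exact hz
  have := (convex_closedBall y0 ‖y - y0‖).norm_image_sub_le_of_norm_hasFDerivWithin_le hder hbd
    (x := y0) (y := y) (by simp) (by simp [dist_eq_norm])
  simp [h0] at this
  simp
  nlinarith [this]

theorem aux_taylor_lim {E ι : Type*} [NormedAddCommGroup E] [NormedSpace ℝ E]
    {ψ : E → ℝ} {y0 : E} (hψ : ContDiffAt ℝ 2 ψ y0) (h0 : ψ y0 = 0) (h1 : fderiv ℝ ψ y0 = 0)
    {l : Filter ι} {t : ι → ℝ} {y : ι → E} {v : E}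
    (ht : Tendsto t l (𝓝 0)) (htp : ∀ᶠ n in l, 0 < t n)
    (hy : Tendsto (fun n => (t n)⁻¹ • (y n - y0)) l (𝓝 v)) :
    Tendsto (fun n => (t n)⁻¹ ^ 2 * ψ (y n)) l
      (𝓝 (2⁻¹ * fderiv ℝ (fderiv ℝ ψ) y0 v v)) := by
  have hT := (aux_taylor hψ h0 h1).comp_tendsto (aux_tendsto ht htp hy)
  set Q := fderiv ℝ (fderiv ℝ ψ) y0 with hQ
  have hA : Tendsto (fun n => (t n)⁻¹ ^ 2 * (ψ (y n) - 2⁻¹ * Q (y n - y0) (y n - y0))) l (𝓝 0) := by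
    have h2 : (fun n => (t n)⁻¹ ^ 2 * (ψ (y n) - 2⁻¹ * Q (y n - y0) (y n - y0))) =o[l]
        (fun n => (t n)⁻¹ ^ 2 * ‖y n - y0‖ ^ 2) :=
      (Asymptotics.isBigO_refl _ _).mul_isLittleO hT
    have h3 : Tendsto (fun n => (t n)⁻¹ ^ 2 * ‖y n - y0‖ ^ 2) l (𝓝 (‖v‖ ^ 2)) := by
      refine (hy.norm.pow 2).congr fun n => ?_
      rw [norm_smul, mul_pow, Real.norm_eq_abs, sq_abs]
    have h4 : (fun n => (t n)⁻¹ ^ 2 * ‖y n - y0‖ ^ 2) =O[l] (fun _ => (1:ℝ)) := h3.isBigO_one ℝ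
    exact (Asymptotics.isLittleO_one_iff ℝ).1 (h2.trans_isBigO h4)
  have hB : Tendsto (fun n => 2⁻¹ * Q ((t n)⁻¹ • (y n - y0)) ((t n)⁻¹ • (y n - y0))) l
      (𝓝 (2⁻¹ * Q v v)) := by
    refine Tendsto.const_mul _ ?_
    have hc : Continuous fun v => Q v v := by fun_prop
    exact (hc.tendsto v).comp hy
  have := hA.add hB
  rw [zero_add] at this
  refine this.congr fun n => ?_
  simp
  ring

/-- local curve -/
theorem aux_curve {E F : Type*} [NormedAddCommGroup E] [NormedSpace ℝ E] [CompleteSpace E]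
    [NormedAddCommGroup F] [NormedSpace ℝ F]
    {Ξ : E → F} {A : E →L[ℝ] F} {R : F →L[ℝ] E} {y0 : E} (hΞ : HasStrictFDerivAt Ξ A y0)
    (h0 : Ξ y0 = 0) (hR : ∀ d, A (R d) = d) :
    ∃ c : E → E, c 0 = y0 ∧ HasFDerivAt c (ContinuousLinearMap.id ℝ E) 0 ∧
      ∀ᶠ v in 𝓝 0, Ξ (c v) = A v := by
  let G : E → E := fun y => (y - y0) + R (Ξ y - A (y - y0))
  have hid : HasStrictFDerivAt (fun y : E => y - y0) (ContinuousLinearMap.id ℝ E) y0 :=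
    (hasStrictFDerivAt_id y0).sub_const y0
  have hG : HasStrictFDerivAt G ((ContinuousLinearEquiv.refl ℝ E : E ≃L[ℝ] E) : E →L[ℝ] E) y0 := by
    have := hid.add (R.hasStrictFDerivAt.comp y0 (hΞ.sub (A.hasStrictFDerivAt.comp y0 hid)))
    refine this.congr_fderiv ?_
    ext v
    simp
  have hG0 : G y0 = 0 := by simp [G, h0]
  refine ⟨hG.localInverse G _ y0, ?_, ?_, ?_⟩
  · have := hG.localInverse_apply_image
    rwa [hG0] at this
  · have := hG.to_localInverse.hasFDerivAt
    rw [hG0] at this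
    exact this
  · have := hG.eventually_right_inverse
    rw [hG0] at this
    filter_upwards [this] with v hv
    have h2 := congrArg A hv
    simp only [G, map_add, hR] at h2
    rw [← h2]; abel

theorem aux_proj {E : Type*} [NormedAddCommGroup E] [InnerProductSpace ℝ E]
    [FiniteDimensional ℝ E] {K : Set E} (hne : K.Nonempty) (hcl : IsClosed K) (z : E) :
    projK K z ∈ K ∧ ∀ y ∈ K, ‖z - projK K z‖ ≤ ‖z - y‖ := by
  have h : ∃ p, p ∈ K ∧ ∀ y ∈ K, ‖z - p‖ ≤ ‖z - y‖ := by
    obtain ⟨p, hp, hpd⟩ := hcl.exists_infDist_eq_dist hne z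
    refine ⟨p, hp, fun y hy => ?_⟩
    rw [← dist_eq_norm, ← dist_eq_norm, ← hpd]
    exact Metric.infDist_le_dist_of_mem hy
  unfold projK
  rw [dif_pos h]
  exact h.choose_spec

theorem aux_proj_ncone {E : Type*} [NormedAddCommGroup E] [InnerProductSpace ℝ E]
    [FiniteDimensional ℝ E] {K : Set E} (hne : K.Nonempty) (hcl : IsClosed K) (hcv : Convex ℝ K)
    (z : E) : z - projK K z ∈ nCone K (projK K z) := by
  obtain ⟨h1, h2⟩ := aux_proj hne hcl z
  refine ⟨h1, ?_⟩
  refine (norm_eq_iInf_iff_real_inner_le_zero hcv h1).1 ?_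
  have : Nonempty K := hne.to_subtype
  apply le_antisymm
  · exact le_ciInf fun w => h2 w w.2
  · exact ciInf_le (f := fun w : K => ‖z - w‖) ⟨0, Set.forall_mem_range.2 fun _ => norm_nonneg _⟩
      ⟨projK K z, h1⟩

/-- Key estimate. -/
theorem aux_est {E : Type*} [NormedAddCommGroup E] [InnerProductSpace ℝ E]
    [FiniteDimensional ℝ E] {K : Set E} (hne : K.Nonempty) (hcl : IsClosed K)
    {y0 l0 : E} (hl : l0 ∈ nCone K y0) {v y : E} (hv : ⟪l0, v⟫ = 0) (hy : y ∈ K) :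
    ‖projK K (y0 + l0 + v) - y0 - v‖ ^ 2 ≤ -2 * ⟪l0, y - y0⟫ + ‖y - y0 - v‖ ^ 2 := by
  obtain ⟨h1, h2⟩ := aux_proj hne hcl (y0 + l0 + v)
  set p := projK K (y0 + l0 + v)
  have h3 := h2 y hy
  have h4 := hl.2 p h1
  have e1 : y0 + l0 + v - p = l0 - (p - y0 - v) := by abel
  have e2 : y0 + l0 + v - y = l0 - (y - y0 - v) := by abel
  rw [e1, e2] at h3
  have h5 := pow_le_pow_left₀ (norm_nonneg _) h3 2
  rw [norm_sub_sq_real l0 (p - y0 - v), norm_sub_sq_real l0 (y - y0 - v),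
    inner_sub_right l0 (p - y0), inner_sub_right l0 (y - y0), hv] at h5
  linarith

theorem aux_proj_self {E : Type*} [NormedAddCommGroup E] [InnerProductSpace ℝ E]
    [FiniteDimensional ℝ E] {K : Set E} (hne : K.Nonempty) (hcl : IsClosed K)
    {y0 l0 : E} (hl : l0 ∈ nCone K y0) : projK K (y0 + l0) = y0 := by
  have := aux_est hne hcl hl (v := 0) (y := y0) (by simp) hl.1
  simp at this
  exact sub_eq_zero.1 this

theorem aux_key {E : Type*} [NormedAddCommGroup E] [InnerProductSpace ℝ E]
    [FiniteDimensional ℝ E] {K : Set E} (hne : K.Nonempty) (hcl : IsClosed K)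
    {y0 l0 : E} (hl : l0 ∈ nCone K y0) (hred : C2ConeReducibleAt K y0)
    {t : ℕ → ℝ} {y lam : ℕ → E} {h : E}
    (ht : Tendsto t atTop (𝓝 0)) (htp : ∀ n, 0 < t n)
    (hy : Tendsto (fun n => (t n)⁻¹ • (y n - y0)) atTop (𝓝 h))
    (hlam : Tendsto (fun n => (t n)⁻¹ • (lam n - l0)) atTop (𝓝 0))
    (hN : ∀ n, lam n ∈ nCone K (y n)) :
    HasDirDeriv (projK K) (y0 + l0) h h := by
  obtain ⟨m, U, D, Ξ, hU, hyU, ⟨hDcl, hDcv, hDcone, -⟩, hΞ, hΞ0, hsurj, hKU⟩ := hred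
  have hΞc : ContDiffAt ℝ 2 Ξ y0 := hΞ.contDiffAt (hU.mem_nhds hyU)
  have hΞs : HasStrictFDerivAt Ξ (fderiv ℝ Ξ y0) y0 := hΞc.hasStrictFDerivAt (by norm_num)
  set A := fderiv ℝ Ξ y0 with hA
  obtain ⟨R0, hR0⟩ := LinearMap.exists_rightInverse_of_surjective A.toLinearMap
    (LinearMap.range_eq_top.2 hsurj)
  let R : EuclideanSpace ℝ (Fin m) →L[ℝ] E := LinearMap.toContinuousLinearMap R0
  have hR : ∀ d, A (R d) = d := fun d => LinearMap.congr_fun hR0 d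
  obtain ⟨c, hc0, hcd, hcΞ⟩ := aux_curve hΞs hΞ0 hR
  have hKU' : ∀ z ∈ U, (z ∈ K ↔ Ξ z ∈ D) := by
    intro z hz
    have := Set.ext_iff.1 hKU z
    simp only [mem_inter_iff, mem_ofPred_eq] at this
    tauto
  -- the curve `s ↦ c (s v)`
  have t0 : Tendsto (fun s : ℝ => s) (𝓝[>] 0) (𝓝 0) := tendsto_id.mono_left nhdsWithin_le_nhds
  have tp : ∀ᶠ s : ℝ in 𝓝[>] 0, 0 < s := self_mem_nhdsWithin
  have sv : ∀ v : E, Tendsto (fun s : ℝ => s • v) (𝓝[>] 0) (𝓝 0) := by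
    intro v
    simpa using t0.smul_const v
  have cl : ∀ v : E, Tendsto (fun s : ℝ => s⁻¹ • (c (s • v) - y0)) (𝓝[>] 0) (𝓝 v) := by
    intro v
    have := aux_lim hcd t0 tp (x := fun s : ℝ => s • v) (v := v) (by
      refine tendsto_const_nhds.congr' ?_
      filter_upwards [tp] with s hs
      rw [sub_zero, smul_smul, inv_mul_cancel₀ hs.ne', one_smul])
    rw [hc0] at this
    exact this
  have cK : ∀ v : E, A v ∈ D → ∀ᶠ s : ℝ in 𝓝[>] 0, c (s • v) ∈ K ∧ Ξ (c (s • v)) = s • A v := by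
    intro v hv
    have h1 := (sv v).eventually hcΞ
    have h2 := (aux_tendsto t0 tp (cl v)).eventually (hU.mem_nhds hyU)
    filter_upwards [h1, h2, tp] with s hs1 hs2 hs
    rw [map_smul] at hs1
    refine ⟨(hKU' _ hs2).2 ?_, hs1⟩
    rw [hs1]
    exact hDcone s hs.le _ hv
  have hpol : ∀ v : E, A v ∈ D → ⟪l0, v⟫ ≤ 0 := by
    intro v hv
    have h1 : Tendsto (fun s : ℝ => ⟪l0, s⁻¹ • (c (s • v) - y0)⟫) (𝓝[>] 0) (𝓝 ⟪l0, v⟫) :=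
      tendsto_const_nhds.inner (cl v)
    refine le_of_tendsto h1 ?_
    filter_upwards [cK v hv, tp] with s hs hs0
    rw [inner_smul_right]
    exact mul_nonpos_of_nonneg_of_nonpos (inv_nonneg.2 (le_of_lt hs0)) (hl.2 _ hs.1)
  have hD0 : (0 : EuclideanSpace ℝ (Fin m)) ∈ D := by
    have := (hKU' y0 hyU).1 hl.1
    rwa [hΞ0] at this
  have hfac : ∀ v : E, ⟪l0, R (A v)⟫ = ⟪l0, v⟫ := by
    intro v
    have k1 := hpol (v - R (A v)) (by rw [map_sub, hR, sub_self]; exact hD0)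
    have k2 := hpol (R (A v) - v) (by rw [map_sub, hR, sub_self]; exact hD0)
    rw [inner_sub_right] at k1 k2
    linarith
  have hDneg : ∀ d ∈ D, ⟪l0, R d⟫ ≤ 0 := fun d hd => hpol _ (by rw [hR]; exact hd)
  -- Taylor
  let ψ : E → ℝ := fun z => ⟪l0, R (Ξ z)⟫ - ⟪l0, z - y0⟫
  have hψ0 : ψ y0 = 0 := by simp [ψ, hΞ0]
  have hψc : ContDiffAt ℝ 2 ψ y0 := by
    have k1 : ContDiffAt ℝ 2 (fun z => R (Ξ z)) y0 := R.contDiff.contDiffAt.comp y0 hΞc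
    exact (contDiffAt_const.inner ℝ k1).sub
      (contDiffAt_const.inner ℝ (contDiffAt_id.sub contDiffAt_const))
  have hψ1 : fderiv ℝ ψ y0 = 0 := by
    have k1 : HasFDerivAt (fun z => innerSL ℝ l0 (R (Ξ z)))
      ((innerSL ℝ l0).comp (R.comp A)) y0 :=
      (innerSL ℝ l0).hasFDerivAt.comp y0 (R.hasFDerivAt.comp y0 hΞs.hasFDerivAt)
    have k2 : HasFDerivAt (fun z => innerSL ℝ l0 (z - y0))
      ((innerSL ℝ l0).comp (ContinuousLinearMap.id ℝ E)) y0 :=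
      (innerSL ℝ l0).hasFDerivAt.comp y0 ((hasFDerivAt_id y0).sub_const y0)
    have k3 : HasFDerivAt ψ _ y0 := k1.sub k2
    rw [k3.fderiv]
    ext v
    simp [hfac]
  have hyt : Tendsto y atTop (𝓝 y0) := aux_tendsto ht (.of_forall htp) hy
  have hevU : ∀ᶠ n in atTop, y n ∈ U := hyt.eventually (hU.mem_nhds hyU)
  -- `A h ∈ D`
  have hAh : A h ∈ D := by
    have k := aux_lim hΞs.hasFDerivAt ht (.of_forall htp) hy
    refine hDcl.mem_of_tendsto k ?_
    filter_upwards [hevU] with n hn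
    rw [hΞ0, sub_zero]
    exact hDcone _ (inv_nonneg.2 (htp n).le) _ ((hKU' _ hn).1 (hN n).1)
  have hmono : ∀ n, -⟪lam n - l0, y n - y0⟫ ≤ ⟪l0, y n - y0⟫ := by
    intro n
    have := (hN n).2 y0 hl.1
    rw [← neg_sub (y n) y0, inner_neg_right] at this
    rw [inner_sub_left]
    linarith
  have hin : Tendsto (fun n => ⟪(t n)⁻¹ • (lam n - l0), (t n)⁻¹ • (y n - y0)⟫) atTop (𝓝 0) := by
    simpa using hlam.inner hy (𝕜 := ℝ)
  have hlh : ⟪l0, h⟫ = 0 := by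
    apply le_antisymm (hpol h hAh)
    have k1 : Tendsto (fun n => ⟪l0, (t n)⁻¹ • (y n - y0)⟫) atTop (𝓝 ⟪l0, h⟫) :=
      tendsto_const_nhds.inner hy
    have k2 : Tendsto (fun n => -(t n * ⟪(t n)⁻¹ • (lam n - l0), (t n)⁻¹ • (y n - y0)⟫)) atTop
        (𝓝 0) := by
      simpa using (ht.mul hin).neg
    refine le_of_tendsto_of_tendsto' k2 k1 fun n => ?_
    rw [inner_smul_left, inner_smul_right, inner_smul_right]
    have k3 := mul_le_mul_of_nonneg_left (hmono n) (inv_nonneg.2 (htp n).le)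
    have k4 : t n * (t n)⁻¹ = 1 := mul_inv_cancel₀ (htp n).ne'
    simp only [conj_trivial]
    calc _ = (t n)⁻¹ * -⟪lam n - l0, y n - y0⟫ := by
            linear_combination (-(t n)⁻¹ * ⟪lam n - l0, y n - y0⟫) * k4
      _ ≤ _ := k3
  set q : ℝ := 2⁻¹ * fderiv ℝ (fderiv ℝ ψ) y0 h h with hq
  have hq0 : q ≤ 0 := by
    have k1 := aux_taylor_lim hψc hψ0 hψ1 ht (.of_forall htp) hy
    refine le_of_tendsto_of_tendsto k1 hin ?_
    filter_upwards [hevU] with n hn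
    have k2 := hDneg _ ((hKU' _ hn).1 (hN n).1)
    have k3 := hmono n
    have k4 : ψ (y n) ≤ ⟪lam n - l0, y n - y0⟫ := by
      simp only [ψ]; linarith
    have k5 := mul_le_mul_of_nonneg_left k4 (sq_nonneg (t n)⁻¹)
    rw [inner_smul_left, inner_smul_right]
    simp only [conj_trivial]
    calc _ ≤ _ := k5
      _ = _ := by ring
  -- the curve in direction `h`
  have k1 := aux_taylor_lim hψc hψ0 hψ1 t0 tp (cl h)
  have k2 : Tendsto (fun s : ℝ => ‖s⁻¹ • (c (s • h) - y0) - h‖ ^ 2) (𝓝[>] 0) (𝓝 0) := by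
    have := (((cl h).sub_const h).norm).pow 2
    simpa using this
  have k3 := (k1.const_mul 2).add k2
  rw [add_zero] at k3
  have k4 : ∀ᶠ s : ℝ in 𝓝[>] 0, ‖s⁻¹ • (projK K (y0 + l0 + s • h) - y0) - h‖ ^ 2 ≤
      2 * (s⁻¹ ^ 2 * ψ (c (s • h))) + ‖s⁻¹ • (c (s • h) - y0) - h‖ ^ 2 := by
    filter_upwards [cK h hAh, tp] with s hs hs0
    have e := aux_est hne hcl hl (v := s • h) (by rw [inner_smul_right, hlh, mul_zero]) hs.1
    have e2 : ψ (c (s • h)) = - ⟪l0, c (s • h) - y0⟫ := by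
      simp only [ψ]
      rw [hs.2, map_smul, inner_smul_right, hfac, hlh]; ring
    have e3 : ∀ w : E, ‖s⁻¹ • w - h‖ ^ 2 = s⁻¹ ^ 2 * ‖w - s • h‖ ^ 2 := by
      intro w
      have : s⁻¹ • w - h = s⁻¹ • (w - s • h) := by
        rw [smul_sub, smul_smul, inv_mul_cancel₀ (ne_of_gt hs0), one_smul]
      rw [this, norm_smul, mul_pow, Real.norm_eq_abs, sq_abs]
    rw [e3, e3, e2]
    have := mul_le_mul_of_nonneg_left e (sq_nonneg s⁻¹)
    linarith
  have hq1 : 0 ≤ 2 * q := by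
    refine ge_of_tendsto k3 ?_
    filter_upwards [k4] with s hs
    exact (sq_nonneg _).trans hs
  have hq2 : 2 * q = 0 := by linarith
  rw [hq2] at k3
  have k5 : Tendsto (fun s : ℝ => ‖s⁻¹ • (projK K (y0 + l0 + s • h) - y0) - h‖ ^ 2)
      (𝓝[>] 0) (𝓝 0) :=
    tendsto_of_tendsto_of_tendsto_of_le_of_le' tendsto_const_nhds k3
      (.of_forall fun s => sq_nonneg _) k4
  have k6 := k5.sqrt
  simp only [Real.sqrt_zero, Real.sqrt_sq (norm_nonneg _)] at k6
  unfold HasDirDeriv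
  rw [aux_proj_self hne hcl hl]
  exact tendsto_iff_norm_sub_tendsto_zero.2 k6

theorem aux_grad (f : X → ℝ) (g : X → Y) (hf : ContDiff ℝ 2 f) (hg : ContDiff ℝ 2 g) (l : Y) :
    (fun u => gradient (fun v => f v + ⟪l, g v⟫) u) =
      fun u => gradient f u + ContinuousLinearMap.adjoint (fderiv ℝ g u) l := by
  funext u
  refine ext_inner_right ℝ fun w => ?_
  have h1 : HasFDerivAt f (fderiv ℝ f u) u := (hf.differentiable (by norm_num) u).hasFDerivAt
  have h2 : HasFDerivAt g (fderiv ℝ g u) u := (hg.differentiable (by norm_num) u).hasFDerivAt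
  have h3 : HasFDerivAt (fun v => f v + innerSL ℝ l (g v))
      (fderiv ℝ f u + (innerSL ℝ l).comp (fderiv ℝ g u)) u :=
    h1.add ((innerSL ℝ l).hasFDerivAt.comp u h2)
  have h4 : fderiv ℝ (fun v => f v + ⟪l, g v⟫) u = _ := h3.fderiv
  rw [inner_add_left, inner_gradient_left, inner_gradient_left,
    ContinuousLinearMap.adjoint_inner_left, h4]
  simp

theorem aux_hess (f : X → ℝ) (g : X → Y) (hf : ContDiff ℝ 2 f) (hg : ContDiff ℝ 2 g)
    (x0 : X) (l : Y) :
    HasFDerivAt (fun u => gradient f u + ContinuousLinearMap.adjoint (fderiv ℝ g u) l)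
      (hessLxx f g x0 l) x0 := by
  rw [← aux_grad f g hf hg l]
  unfold hessLxx
  apply DifferentiableAt.hasFDerivAt
  let T : (X →L[ℝ] ℝ) →ₗ[ℝ] X :=
    { toFun := fun φ => (InnerProductSpace.toDual ℝ X).symm φ
      map_add' := fun a b => by simp
      map_smul' := fun a b => by simp }
  have hL : ContDiff ℝ 2 (fun v => f v + ⟪l, g v⟫) := hf.add (contDiff_const.inner ℝ hg)
  have h1 : ContDiff ℝ 1 (fderiv ℝ (fun v => f v + ⟪l, g v⟫)) := hL.fderiv_right (by norm_num)
  have h2 := (LinearMap.toContinuousLinearMap T).differentiableAt.comp x0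
    (h1.differentiable (by norm_num) x0)
  exact h2

theorem aux_adj {ι : Type*} (g : X → Y) (hg : ContDiff ℝ 2 g) {l : Filter ι} {x : ι → X} {w : ι → Y}
    {x0 : X} (hx : Tendsto x l (𝓝 x0)) (hw : Tendsto w l (𝓝 0)) :
    Tendsto (fun n => ContinuousLinearMap.adjoint (fderiv ℝ g (x n)) (w n)) l (𝓝 0) := by
  have h1 : Continuous (fderiv ℝ g) := hg.continuous_fderiv (by norm_num)
  have h2 : Tendsto (fun n => ContinuousLinearMap.adjoint (fderiv ℝ g (x n))) l
      (𝓝 (ContinuousLinearMap.adjoint (fderiv ℝ g x0))) :=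
    (ContinuousLinearMap.adjoint.continuous.tendsto _).comp ((h1.tendsto x0).comp hx)
  have h3 := (isBoundedBilinearMap_apply (𝕜 := ℝ) (E := Y) (F := X)).continuous.tendsto
    (ContinuousLinearMap.adjoint (fderiv ℝ g x0), 0)
  have h4 := h3.comp (h2.prodMk_nhds hw)
  simp only [map_zero] at h4
  exact h4

theorem aux_forward (f : X → ℝ) (g : X → Y) (K : Set Y)
    (hf : ContDiff ℝ 2 f) (hg : ContDiff ℝ 2 g)
    (hKne : K.Nonempty) (hKcl : IsClosed K) (hKcv : Convex ℝ K)
    (x0 : X) (l0 : Y) (hKKT : l0 ∈ mSet f g K x0 0 0)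
    (hcalm : IsolatedCalm
      (fun q : Y × X × Y => {x : X | (x, q.1) ∈ sKKT f g K q.2.1 q.2.2})
      (l0, 0, 0) x0) (ξ : X) (hH : hessLxx f g x0 l0 ξ = 0)
    (hD : HasDirDeriv (projK K) (g x0 + l0) (fderiv ℝ g x0 ξ) (fderiv ℝ g x0 ξ)) : ξ = 0 := by
  obtain ⟨hst, hl⟩ : gradient f x0 + ContinuousLinearMap.adjoint (fderiv ℝ g x0) l0 = 0 ∧
    l0 ∈ nCone K (g x0 - 0) := hKKT
  rw [sub_zero] at hl
  obtain ⟨κ, ε, δ, hκ, hε, hδ, hcalm⟩ := hcalm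
  have t0 : Tendsto (fun s : ℝ => s) (𝓝[>] 0) (𝓝 0) := tendsto_id.mono_left nhdsWithin_le_nhds
  have tp : ∀ᶠ s : ℝ in 𝓝[>] 0, 0 < s := self_mem_nhdsWithin
  set h := fderiv ℝ g x0 ξ with hh
  unfold HasDirDeriv at hD
  rw [aux_proj_self hKne hKcl hl] at hD
  let x : ℝ → X := fun s => x0 + s • ξ
  let p : ℝ → Y := fun s => projK K (g x0 + l0 + s • h)
  let lam : ℝ → Y := fun s => g x0 + l0 + s • h - p s
  let b : ℝ → Y := fun s => g (x s) - p s
  let a : ℝ → X := fun s => gradient f (x s) + ContinuousLinearMap.adjoint (fderiv ℝ g (x s)) (lam s)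
  have hx : Tendsto (fun s => s⁻¹ • (x s - x0)) (𝓝[>] 0) (𝓝 ξ) := by
    refine tendsto_const_nhds.congr' ?_
    filter_upwards [tp] with s hs
    simp [x, smul_smul, inv_mul_cancel₀ hs.ne']
  have hxt := aux_tendsto t0 tp hx
  have hlam : Tendsto (fun s => s⁻¹ • (lam s - l0)) (𝓝[>] 0) (𝓝 0) := by
    have := hD.const_sub h
    rw [sub_self] at this
    refine this.congr' ?_
    filter_upwards [tp] with s hs
    have e : lam s - l0 = s • h - (p s - g x0) := by simp only [lam]; abel
    rw [e, smul_sub s⁻¹ (s • h), smul_smul, inv_mul_cancel₀ hs.ne', one_smul]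
  have hb : Tendsto (fun s => s⁻¹ • b s) (𝓝[>] 0) (𝓝 0) := by
    have k := aux_lim (hg.differentiable (by norm_num) x0).hasFDerivAt t0 tp hx
    have := k.sub hD
    rw [sub_self] at this
    refine this.congr fun s => ?_
    rw [← smul_sub]
    congr 1
    simp only [b, p]; abel
  have ha : Tendsto (fun s => s⁻¹ • a s) (𝓝[>] 0) (𝓝 0) := by
    have k := aux_lim (aux_hess f g hf hg x0 l0) t0 tp hx
    have := k.add (aux_adj g hg hxt hlam)
    rw [hH, add_zero] at this
    refine this.congr fun s => ?_
    rw [hst, map_smul, ← smul_add, map_sub]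
    congr 1
    simp only [a]; abel
  have hz : Tendsto (fun s => s⁻¹ • ((lam s, a s, b s) - (l0, 0, 0) : Y × X × Y)) (𝓝[>] 0)
      (𝓝 0) := by
    have := hlam.prodMk_nhds (ha.prodMk_nhds hb)
    refine this.congr fun s => ?_
    simp
  have hzt : Tendsto (fun s => ((lam s, a s, b s) : Y × X × Y)) (𝓝[>] 0) (𝓝 (l0, 0, 0)) :=
    aux_tendsto t0 tp hz
  have e1 : ∀ᶠ s : ℝ in 𝓝[>] 0, ‖((lam s, a s, b s) - (l0, 0, 0) : Y × X × Y)‖ ≤ ε := by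
    filter_upwards [hzt.eventually (Metric.closedBall_mem_nhds _ hε)] with s hs
    rwa [dist_eq_norm] at hs
  have e2 : ∀ᶠ s : ℝ in 𝓝[>] 0, ‖x s - x0‖ ≤ δ := by
    filter_upwards [hxt.eventually (Metric.closedBall_mem_nhds _ hδ)] with s hs
    rwa [dist_eq_norm] at hs
  have hfin := hz.norm.const_mul κ
  rw [norm_zero, mul_zero] at hfin
  have : ‖ξ‖ ≤ 0 := by
    refine le_of_tendsto_of_tendsto hx.norm hfin ?_
    filter_upwards [e1, e2, tp] with s h1 h2 h3
    have := hcalm (lam s, a s, b s) h1 (x s) (by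
      refine ⟨rfl, ?_⟩
      have e : g (x s) - b s = p s := by simp [b]
      change lam s ∈ nCone K (g (x s) - b s)
      rw [e]
      exact aux_proj_ncone hKne hKcl hKcv _) h2
    rw [norm_smul, norm_smul]
    have k := mul_le_mul_of_nonneg_left this (norm_nonneg s⁻¹)
    linarith
  exact norm_le_zero_iff.1 this

theorem aux_backward (f : X → ℝ) (g : X → Y) (K : Set Y)
    (hf : ContDiff ℝ 2 f) (hg : ContDiff ℝ 2 g)
    (hKne : K.Nonempty) (hKcl : IsClosed K)
    (hKred : C2ConeReducible K)
    (x0 : X) (l0 : Y) (hKKT : l0 ∈ mSet f g K x0 0 0)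
    (huniq : ∀ ξ : X, hessLxx f g x0 l0 ξ = 0 →
        HasDirDeriv (projK K) (g x0 + l0) (fderiv ℝ g x0 ξ) (fderiv ℝ g x0 ξ) →
        ξ = 0) :
    IsolatedCalm
      (fun q : Y × X × Y => {x : X | (x, q.1) ∈ sKKT f g K q.2.1 q.2.2})
      (l0, 0, 0) x0 := by
  obtain ⟨hst, hl⟩ : gradient f x0 + ContinuousLinearMap.adjoint (fderiv ℝ g x0) l0 = 0 ∧
    l0 ∈ nCone K (g x0 - 0) := hKKT
  rw [sub_zero] at hl
  by_contra hcon
  have hcon' : ∀ n : ℕ, ∃ z : Y × X × Y, ∃ w : X,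
      ‖w - x0‖ ≤ 1 / ((n : ℝ) + 1) ∧ (w, z.1) ∈ sKKT f g K z.2.1 z.2.2 ∧
      ((n : ℝ) + 1) * ‖z - (l0, 0, 0)‖ < ‖w - x0‖ := by
    intro n
    by_contra hn
    push Not at hn
    have hpos : (0 : ℝ) < 1 / ((n : ℝ) + 1) := by positivity
    exact hcon ⟨(n : ℝ) + 1, 1, 1 / ((n : ℝ) + 1), by positivity, one_pos, hpos,
      fun z _ w hw hwd => hn z w hwd hw⟩
  choose z x hx1 hx2 hx3 using hcon'
  have htp : ∀ n, 0 < ‖x n - x0‖ := fun n => lt_of_le_of_lt (by positivity) (hx3 n)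
  have hsph : ∀ n, ‖x n - x0‖⁻¹ • (x n - x0) ∈ Metric.sphere (0 : X) 1 := by
    intro n
    rw [mem_sphere_zero_iff_norm, norm_smul, norm_inv, norm_norm, inv_mul_cancel₀ (htp n).ne']
  obtain ⟨ξ, hξ, φ, hφ, hlim⟩ := (isCompact_sphere (0 : X) 1).tendsto_subseq hsph
  have hinv : Tendsto (fun n : ℕ => 1 / ((n : ℝ) + 1)) atTop (𝓝 0) :=
    tendsto_one_div_add_atTop_nhds_zero_nat
  have ht' : Tendsto (fun n => ‖x n - x0‖) atTop (𝓝 0) :=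
    squeeze_zero (fun n => norm_nonneg _) hx1 hinv
  have hz' : Tendsto (fun n => ‖x n - x0‖⁻¹ • (z n - (l0, 0, 0))) atTop (𝓝 0) := by
    rw [tendsto_zero_iff_norm_tendsto_zero]
    refine squeeze_zero (fun n => norm_nonneg _) (fun n => ?_) hinv
    rw [norm_smul, norm_inv, norm_norm, inv_mul_le_iff₀ (htp n), mul_one_div,
      le_div_iff₀ (by positivity)]
    linarith [hx3 n]
  have ht : Tendsto (fun n => ‖x (φ n) - x0‖) atTop (𝓝 0) := ht'.comp hφ.tendsto_atTop
  have hz := hz'.comp hφ.tendsto_atTop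
  have hx : Tendsto (fun n => ‖x (φ n) - x0‖⁻¹ • (x (φ n) - x0)) atTop (𝓝 ξ) := hlim
  have htp' : ∀ᶠ n in atTop, 0 < ‖x (φ n) - x0‖ := .of_forall fun n => htp _
  have hxt := aux_tendsto ht htp' hx
  have hlam : Tendsto (fun n => ‖x (φ n) - x0‖⁻¹ • ((z (φ n)).1 - l0)) atTop (𝓝 0) :=
    (continuous_fst.tendsto (0 : Y × X × Y)).comp hz
  have ha : Tendsto (fun n => ‖x (φ n) - x0‖⁻¹ • ((z (φ n)).2.1 - 0)) atTop (𝓝 0) :=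
    ((continuous_fst.comp continuous_snd).tendsto (0 : Y × X × Y)).comp hz
  have hb : Tendsto (fun n => ‖x (φ n) - x0‖⁻¹ • ((z (φ n)).2.2 - 0)) atTop (𝓝 0) :=
    ((continuous_snd.comp continuous_snd).tendsto (0 : Y × X × Y)).comp hz
  have hH : hessLxx f g x0 l0 ξ = 0 := by
    have k := aux_lim (aux_hess f g hf hg x0 l0) ht htp' hx
    have k2 := ha.sub (aux_adj g hg hxt hlam)
    rw [sub_zero] at k2
    refine tendsto_nhds_unique k (k2.congr fun n => ?_)
    have e := (hx2 (φ n)).1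
    simp only at e
    rw [hst, ← e, map_smul, ← smul_sub, map_sub]
    congr 1
    abel
  have hyl : Tendsto (fun n => ‖x (φ n) - x0‖⁻¹ • ((g (x (φ n)) - (z (φ n)).2.2) - g x0)) atTop
      (𝓝 (fderiv ℝ g x0 ξ)) := by
    have k := aux_lim (hg.differentiable (by norm_num) x0).hasFDerivAt ht htp' hx
    have k2 := k.sub hb
    rw [sub_zero] at k2
    refine k2.congr fun n => ?_
    rw [← smul_sub]
    congr 1
    abel
  have hDD := aux_key hKne hKcl hl (hKred _ hl.1) ht (fun n => htp _) hyl hlam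
    (fun n => (hx2 (φ n)).2)
  have := huniq ξ hH hDD
  rw [this] at hξ
  simp at hξ

/-- Proposition 3.1(b): the localized stationary-point map
`X(λ,a,b) = {x | (x,λ) ∈ S_KKT(a,b)}` is isolated calm at `(λ̄,0,0)` for `x̄` iff `ξ = 0`
is the only solution of `∇²ₓₓL(x̄,λ̄)ξ = 0`, `g'(x̄)ξ − Π_K'(g(x̄)+λ̄; g'(x̄)ξ) = 0`. -/
theorem stmt_7 (f : X → ℝ) (g : X → Y) (K : Set Y)
    (hf : ContDiff ℝ 2 f) (hg : ContDiff ℝ 2 g)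
    (hKne : K.Nonempty) (hKcl : IsClosed K) (hKcv : Convex ℝ K)
    (hKred : C2ConeReducible K)
    (x0 : X) (l0 : Y) (hKKT : l0 ∈ mSet f g K x0 0 0) :
    IsolatedCalm
      (fun q : Y × X × Y => {x : X | (x, q.1) ∈ sKKT f g K q.2.1 q.2.2})
      (l0, 0, 0) x0
    ↔ (∀ ξ : X, hessLxx f g x0 l0 ξ = 0 →
        HasDirDeriv (projK K) (g x0 + l0) (fderiv ℝ g x0 ξ) (fderiv ℝ g x0 ξ) →
        ξ = 0) := by
  constructor
  · intro h ξ h1 h2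
    exact aux_forward f g K hf hg hKne hKcl hKcv x0 l0 hKKT h ξ h1 h2
  · intro h
    exact aux_backward f g K hf hg hKne hKcl hKred x0 l0 hKKT h

end
end

section
/- Let (x̄,λ̄) be a KKT point of the unperturbed problem (a,b)=(0,0). If X_KKT has the pseudo-isolated calmness at the origin for x̄ (relative to λ̄), then the multiplier λ̄ is noncritical, i.e., every solution (ξ,v) ∈ X × Y of the system ∇²ₓₓL(x̄,λ̄)ξ + ∇g(x̄)*v = 0 and g'(x̄)ξ − Π_K'(g(x̄)+λ̄; g'(x̄)ξ + v) = 0 has ξ = 0. -/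
open Set Filter Topology Metric Pointwise
open scoped RealInnerProductSpace Classical

noncomputable section

variable {X Y : Type*} [NormedAddCommGroup X] [InnerProductSpace ℝ X]
  [FiniteDimensional ℝ X] [NormedAddCommGroup Y] [InnerProductSpace ℝ Y]
  [FiniteDimensional ℝ Y]

lemma projK_spec_s10 {E : Type*} [NormedAddCommGroup E] [InnerProductSpace ℝ E]
    [FiniteDimensional ℝ E] (K : Set E)
    (hKne : K.Nonempty) (hKcl : IsClosed K) (hKcv : Convex ℝ K) (z : E) :
    z - projK K z ∈ nCone K (projK K z) := by
  have hex : ∃ p, p ∈ K ∧ ∀ y ∈ K, ‖z - p‖ ≤ ‖z - y‖ := by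
    obtain ⟨p, hp, h⟩ := hKcl.exists_infDist_eq_dist hKne z
    refine ⟨p, hp, fun y hy => ?_⟩
    rw [← dist_eq_norm, ← dist_eq_norm, ← h]
    exact infDist_le_dist_of_mem hy
  have hs : projK K z ∈ K ∧ ∀ y ∈ K, ‖z - projK K z‖ ≤ ‖z - y‖ := by
    unfold projK
    rw [dif_pos hex]
    exact hex.choose_spec
  refine ⟨hs.1, ?_⟩
  rw [← norm_eq_iInf_iff_real_inner_le_zero hKcv hs.1]
  have : Nonempty K := ⟨⟨_, hs.1⟩⟩
  apply le_antisymm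
  · exact le_ciInf fun w => hs.2 w w.2
  · exact ciInf_le ⟨0, by rintro _ ⟨w, rfl⟩; exact norm_nonneg _⟩ (⟨_, hs.1⟩ : K)

lemma nCone_unique {E : Type*} [NormedAddCommGroup E] [InnerProductSpace ℝ E]
    (K : Set E) (z p q : E) (hp : z - p ∈ nCone K p) (hq : z - q ∈ nCone K q) : p = q := by
  have h1 := hp.2 q hq.1
  have h2 := hq.2 p hp.1
  have h3 : ⟪p - q, p - q⟫ = ⟪z - p, q - p⟫ + ⟪z - q, p - q⟫ := by
    have : p - q = (z - q) - (z - p) := by abel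
    nth_rewrite 1 [this]
    rw [inner_sub_left, ← neg_sub p q, inner_neg_right]; ring
  have h4 : ⟪p - q, p - q⟫ ≤ 0 := by linarith
  exact sub_eq_zero.1 (inner_self_eq_zero (𝕜 := ℝ).1 (le_antisymm h4 real_inner_self_nonneg))

lemma grad_lag (f : X → ℝ) (g : X → Y)
    (hf : ContDiff ℝ 2 f) (hg : ContDiff ℝ 2 g) (l : Y) (u : X) :
    gradient (fun v => f v + ⟪l, g v⟫) u
      = gradient f u + ContinuousLinearMap.adjoint (fderiv ℝ g u) l := by
  have hfd : HasFDerivAt f (fderiv ℝ f u) u := (hf.differentiable (by norm_num) u).hasFDerivAt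
  have hgd : HasFDerivAt g (fderiv ℝ g u) u := (hg.differentiable (by norm_num) u).hasFDerivAt
  have h := hfd.add ((innerSL ℝ l).hasFDerivAt.comp u hgd)
  have h2 : fderiv ℝ (fun v => f v + ⟪l, g v⟫) u = fderiv ℝ f u + (innerSL ℝ l).comp (fderiv ℝ g u) :=
    h.fderiv
  unfold gradient
  rw [h2, map_add]
  congr 1

lemma lag_diff (f : X → ℝ) (g : X → Y)
    (hf : ContDiff ℝ 2 f) (hg : ContDiff ℝ 2 g) (l : Y) (x : X) :
    HasFDerivAt (fun u => gradient (fun v => f v + ⟪l, g v⟫) u) (hessLxx f g x l) x := by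
  apply DifferentiableAt.hasFDerivAt
  unfold gradient
  have h : ContDiff ℝ 2 (fun v => f v + ⟪l, g v⟫) := hf.add (contDiff_const.inner ℝ hg)
  have h1 : Differentiable ℝ (fderiv ℝ (fun v => f v + ⟪l, g v⟫)) :=
    (h.fderiv_right (m := 1) (by norm_num)).differentiable (by norm_num)
  exact ((InnerProductSpace.toDual ℝ X).symm.toContinuousLinearEquiv.differentiableAt).comp x (h1 x)

lemma dir_tendsto {E F : Type*} [NormedAddCommGroup E] [NormedSpace ℝ E]
    [NormedAddCommGroup F] [NormedSpace ℝ F] {φ : E → F} {φ' : E →L[ℝ] F} {x : E}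
    (h : HasFDerivAt φ φ' x) (ξ : E) :
    Tendsto (fun t : ℝ => t⁻¹ • (φ (x + t • ξ) - φ x)) (𝓝[>] (0 : ℝ)) (𝓝 (φ' ξ)) :=
  (h.hasLineDerivAt ξ).tendsto_slope_zero_right

/-- Proposition 4.1: if `X_KKT` has the pseudo-isolated calmness at
the origin for `x̄` (relative to `λ̄`), then the multiplier `λ̄` is noncritical. -/
theorem stmt_10 (f : X → ℝ) (g : X → Y) (K : Set Y)
    (hf : ContDiff ℝ 2 f) (hg : ContDiff ℝ 2 g)
    (hKne : K.Nonempty) (hKcl : IsClosed K) (hKcv : Convex ℝ K)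
    (hKred : C2ConeReducible K)
    (x0 : X) (l0 : Y) (hKKT : (x0, l0) ∈ sKKT f g K 0 0)
    (hpic : PseudoIsolatedCalm f g K x0 l0) :
    Noncritical f g K x0 l0 := by
  intro ξ v h1 h2
  have hl : l0 ∈ nCone K (g x0) := by simpa using hKKT.2
  have hL0 : gradient f x0 + ContinuousLinearMap.adjoint (fderiv ℝ g x0) l0 = 0 := hKKT.1
  have hp0 : projK K (g x0 + l0) = g x0 := by
    apply nCone_unique K (g x0 + l0) _ _ (projK_spec_s10 K hKne hKcl hKcv _)
    simpa using hl
  obtain ⟨ε, δ, κ, hε, hδ, hκ, H⟩ := hpic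
  set A := fderiv ℝ g x0 with hA
  let p : ℝ → Y := fun t => projK K (g x0 + l0 + t • (A ξ + v))
  let l : ℝ → Y := fun t => g x0 + l0 + t • (A ξ + v) - p t
  let x : ℝ → X := fun t => x0 + t • ξ
  let a : ℝ → X := fun t => gradient f (x t) + ContinuousLinearMap.adjoint (fderiv ℝ g (x t)) (l t)
  let b : ℝ → Y := fun t => g (x t) - p t
  have hmem : ∀ t, (x t, l t) ∈ sKKT f g K (a t) (b t) := by
    intro t
    refine ⟨rfl, ?_⟩
    have := projK_spec_s10 K hKne hKcl hKcv (g x0 + l0 + t • (A ξ + v))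
    simpa [b, l, p] using this
  have hpos : ∀ᶠ t : ℝ in 𝓝[>] (0 : ℝ), 0 < t := eventually_mem_nhdsWithin
  have hid : Tendsto (fun t : ℝ => t) (𝓝[>] (0 : ℝ)) (𝓝 0) :=
    tendsto_nhdsWithin_of_tendsto_nhds tendsto_id
  have hp : Tendsto (fun t : ℝ => t⁻¹ • (p t - g x0)) (𝓝[>] (0 : ℝ)) (𝓝 (A ξ)) := by
    have := h2
    unfold HasDirDeriv at this
    rw [hp0] at this
    exact this
  have hgd : HasFDerivAt g A x0 := (hg.differentiable (by norm_num) x0).hasFDerivAt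
  have hb : Tendsto (fun t : ℝ => t⁻¹ • b t) (𝓝[>] (0 : ℝ)) (𝓝 0) := by
    have := (dir_tendsto hgd ξ).sub hp
    rw [sub_self] at this
    refine this.congr fun t => ?_
    rw [← smul_sub]
    simp [b, x]
  have hlv : Tendsto (fun t : ℝ => t⁻¹ • (l t - l0)) (𝓝[>] (0 : ℝ)) (𝓝 v) := by
    have : Tendsto (fun t : ℝ => (A ξ + v) - t⁻¹ • (p t - g x0)) (𝓝[>] (0 : ℝ)) (𝓝 v) := by
      have := (tendsto_const_nhds (x := A ξ + v)).sub hp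
      simpa using this
    refine this.congr' ?_
    filter_upwards [hpos] with t ht
    have e : l t - l0 = t • (A ξ + v) - (p t - g x0) := by simp only [l]; abel
    rw [e, smul_sub t⁻¹ (t • (A ξ + v)), smul_smul, inv_mul_cancel₀ ht.ne', one_smul]
  have hx : Tendsto x (𝓝[>] (0 : ℝ)) (𝓝 x0) := by
    have := (tendsto_const_nhds (x := x0)).add (hid.smul_const ξ)
    simpa using this
  have hll : Tendsto l (𝓝[>] (0 : ℝ)) (𝓝 l0) := by
    have := (tendsto_const_nhds (x := l0)).add (hid.smul hlv)
    rw [zero_smul, add_zero] at this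
    refine this.congr' ?_
    filter_upwards [hpos] with t ht
    rw [smul_smul, mul_inv_cancel₀ ht.ne', one_smul]; abel
  have hadj : Tendsto (fun t => ContinuousLinearMap.adjoint (fderiv ℝ g (x t))) (𝓝[>] (0 : ℝ))
      (𝓝 (ContinuousLinearMap.adjoint A)) := by
    have hc : Continuous (fderiv ℝ g) := hg.continuous_fderiv (by norm_num)
    exact ((ContinuousLinearMap.adjoint (𝕜 := ℝ) (E := X) (F := Y)).continuous.tendsto _).comp
      ((hc.tendsto x0).comp hx)
  have ha : Tendsto (fun t : ℝ => t⁻¹ • a t) (𝓝[>] (0 : ℝ)) (𝓝 0) := by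
    have := (dir_tendsto (lag_diff f g hf hg l0 x0) ξ).add 
      ((isBoundedBilinearMap_apply (𝕜 := ℝ) (E := Y) (F := X)).continuous.tendsto
        (ContinuousLinearMap.adjoint A, v) |>.comp (hadj.prodMk_nhds hlv))
    rw [h1] at this
    refine this.congr fun t => ?_
    simp only [Function.comp]
    rw [grad_lag f g hf hg, grad_lag f g hf hg, hL0, sub_zero, map_smul, ← smul_add, map_sub]
    congr 1
    simp only [a, x]; abel
  have hab : Tendsto (fun t : ℝ => ((t⁻¹ • a t, t⁻¹ • b t) : X × Y)) (𝓝[>] (0 : ℝ)) (𝓝 0) :=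
    ha.prodMk_nhds hb
  have hab0 : Tendsto (fun t : ℝ => ((a t, b t) : X × Y)) (𝓝[>] (0 : ℝ)) (𝓝 0) := by
    have := hid.smul hab
    rw [zero_smul] at this
    refine this.congr' ?_
    filter_upwards [hpos] with t ht
    simp [smul_smul, mul_inv_cancel₀ ht.ne']
  have e1 : ∀ᶠ t in 𝓝[>] (0 : ℝ), ‖((a t, b t) : X × Y)‖ ≤ δ := by
    have := hab0.norm
    rw [norm_zero] at this
    exact this.eventually_le_const hδ
  have e2 : ∀ᶠ t in 𝓝[>] (0 : ℝ), ‖((x t, l t) : X × Y) - (x0, l0)‖ ≤ ε := by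
    have := ((hx.prodMk_nhds hll).sub_const (x0, l0)).norm
    rw [sub_self, norm_zero] at this
    exact this.eventually_le_const hε
  have e3 : ∀ᶠ t in 𝓝[>] (0 : ℝ), ‖ξ‖ ≤ κ * ‖((t⁻¹ • a t, t⁻¹ • b t) : X × Y)‖ := by
    filter_upwards [e1, e2, hpos] with t h1 h2 ht
    have h3 := H (a t) (b t) h1 (x t) (l t) (hmem t) h2
    have e4 : ‖x t - x0‖ = t * ‖ξ‖ := by
      simp [x, norm_smul, abs_of_pos ht]
    have e5 : ‖((t⁻¹ • a t, t⁻¹ • b t) : X × Y)‖ = t⁻¹ * ‖((a t, b t) : X × Y)‖ := by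
      rw [← Prod.smul_mk, norm_smul, Real.norm_eq_abs, abs_of_pos (inv_pos.2 ht)]
    rw [e4] at h3
    rw [e5]
    have h4 := mul_le_mul_of_nonneg_left h3 (inv_pos.2 ht).le
    rw [← mul_assoc, inv_mul_cancel₀ ht.ne', one_mul] at h4
    linarith
  have hlim := (hab.norm).const_mul κ
  rw [norm_zero, mul_zero] at hlim
  have := ge_of_tendsto hlim e3
  exact norm_le_zero_iff.1 this

end
end
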